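/- (Existence and uniqueness for 2D nonlinear Young equations.) Let T > 0, γ = (γ₁,γ₂) ∈ (1/2,1]² and η ∈ (0,1) with (1+η)γᵢ > 1 for i = 1,2. Let A ∈ C^γ_t C^{2+η}_x and let ξ ∈ C^γ([0,T]²;ℝ^d) satisfy □_{s,t}ξ = 0 for all s ≤ t ∈ [0,T]². Then there exists a unique θ ∈ C^γ([0,T]²;ℝ^d) such that for all t ∈ [0,T]²: θ_t = ξ_t + ∫_0^t A(ds, θ_s), where the integral is the 2D nonlinear Young integral. -/

import Mathlib

open Set Filter MeasureTheory
open scoped Topology ENNReal NNReal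

noncomputable section

namespace Plane

/-- The square `[0,T]²` in `ℝ × ℝ`, with the product (coordinatewise) order. -/
def Sq (T : ℝ) : Set (ℝ × ℝ) := Set.Icc (0, 0) (T, T)

variable {E : Type*} [NormedAddCommGroup E]

/-- The rectangular increment `□_{s,t} f`. -/
def box (f : ℝ × ℝ → E) (s t : ℝ × ℝ) : E :=
  f (t.1, t.2) - f (t.1, s.2) - f (s.1, t.2) + f (s.1, s.2)

/-- `m(t-s)^α = |t₁-s₁|^{α₁} |t₂-s₂|^{α₂}`. -/
def mPow (α : ℝ × ℝ) (s t : ℝ × ℝ) : ℝ :=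
  |t.1 - s.1| ^ α.1 * |t.2 - s.2| ^ α.2

/-- Values entering the `(1,0)` 2D Hölder semi-norm of `f` over the region `R`. -/
def hSet10 (R : Set (ℝ × ℝ)) (a : ℝ) (f : ℝ × ℝ → E) : Set ℝ :=
  {v | ∃ s ∈ R, ∃ t ∈ R, v = ‖f (t.1, s.2) - f (s.1, s.2)‖ / |t.1 - s.1| ^ a}

/-- Values entering the `(0,1)` 2D Hölder semi-norm of `f` over the region `R`. -/
def hSet01 (R : Set (ℝ × ℝ)) (a : ℝ) (f : ℝ × ℝ → E) : Set ℝ :=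
  {v | ∃ s ∈ R, ∃ t ∈ R, v = ‖f (s.1, t.2) - f (s.1, s.2)‖ / |t.2 - s.2| ^ a}

/-- Values entering the `(1,1)` (rectangular) 2D Hölder semi-norm of `f` over `R`. -/
def hSet11 (R : Set (ℝ × ℝ)) (α : ℝ × ℝ) (f : ℝ × ℝ → E) : Set ℝ :=
  {v | ∃ s ∈ R, ∃ t ∈ R, v = ‖box f s t‖ / mPow α s t}

/-- The `(1,0)` 2D Hölder semi-norm `[f]_{(1,0),α}` over `R`. -/
def semi10 (R : Set (ℝ × ℝ)) (a : ℝ) (f : ℝ × ℝ → E) : ℝ := sSup (hSet10 R a f)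

/-- The `(0,1)` 2D Hölder semi-norm `[f]_{(0,1),α}` over `R`. -/
def semi01 (R : Set (ℝ × ℝ)) (a : ℝ) (f : ℝ × ℝ → E) : ℝ := sSup (hSet01 R a f)

/-- The `(1,1)` 2D Hölder semi-norm `[f]_{(1,1),α}` over `R`. -/
def semi11 (R : Set (ℝ × ℝ)) (α : ℝ × ℝ) (f : ℝ × ℝ → E) : ℝ := sSup (hSet11 R α f)

/-- The full 2D Hölder semi-norm `[f]_α`. -/
def semiH (R : Set (ℝ × ℝ)) (α : ℝ × ℝ) (f : ℝ × ℝ → E) : ℝ :=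
  semi10 R α.1 f + semi01 R α.2 f + semi11 R α f

/-- Membership in the 2D Hölder space `C^α` over the region `R`:
the three semi-norms are finite. -/
def MemHolder (R : Set (ℝ × ℝ)) (α : ℝ × ℝ) (f : ℝ × ℝ → E) : Prop :=
  BddAbove (hSet10 R α.1 f) ∧ BddAbove (hSet01 R α.2 f) ∧ BddAbove (hSet11 R α f)

/-- A (one-dimensional) partition of `[a,b]` into consecutive subintervals. -/
structure Partition (a b : ℝ) where
  n : ℕ
  pts : Fin (n + 2) → ℝ
  mono : Monotone pts
  first : pts 0 = a
  last : pts (Fin.last (n + 1)) = b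

/-- The mesh (maximal subinterval length) of a partition. -/
def Partition.mesh {a b : ℝ} (P : Partition a b) : ℝ :=
  Finset.univ.sup' Finset.univ_nonempty fun i : Fin (P.n + 1) =>
    P.pts i.succ - P.pts i.castSucc

/-- The Riemann sum of a germ `Ξ` over a product partition `P × Q`. -/
def riemannSum (Ξ : ℝ × ℝ → ℝ × ℝ → E) {a₁ b₁ a₂ b₂ : ℝ}
    (P : Partition a₁ b₁) (Q : Partition a₂ b₂) : E :=
  ∑ i : Fin (P.n + 1), ∑ j : Fin (Q.n + 1),
    Ξ (P.pts i.castSucc, Q.pts j.castSucc) (P.pts i.succ, Q.pts j.succ)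

/-- The Riemann sums of the germ `Ξ` over the rectangle `[s,t]` converge to `L` along every
sequence of product partitions with mesh tending to `0`. -/
def SewsTo (Ξ : ℝ × ℝ → ℝ × ℝ → E) (s t : ℝ × ℝ) (L : E) : Prop :=
  ∀ (P : ℕ → Partition s.1 t.1) (Q : ℕ → Partition s.2 t.2),
    Tendsto (fun k => max (P k).mesh (Q k).mesh) atTop (𝓝 0) →
    Tendsto (fun k => riemannSum Ξ (P k) (Q k)) atTop (𝓝 L)

/-- `δ¹_u Ξ_{s,t}`. -/
def delta1 (Ξ : ℝ × ℝ → ℝ × ℝ → E) (s u t : ℝ × ℝ) : E :=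
  Ξ s t - Ξ s (u.1, t.2) - Ξ (u.1, s.2) t

/-- `δ²_u Ξ_{s,t}`. -/
def delta2 (Ξ : ℝ × ℝ → ℝ × ℝ → E) (s u t : ℝ × ℝ) : E :=
  Ξ s t - Ξ s (t.1, u.2) - Ξ (s.1, u.2) t

/-- `δ¹_u ∘ δ²_u Ξ_{s,t}`. -/
def delta12 (Ξ : ℝ × ℝ → ℝ × ℝ → E) (s u t : ℝ × ℝ) : E :=
  delta1 (fun a b => delta2 Ξ a u b) s u t

variable {X Y : Type*} [NormedAddCommGroup X] [NormedSpace ℝ X]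
  [NormedAddCommGroup Y] [NormedSpace ℝ Y]

/-- `‖g‖_{C^{1+η}_b} ≤ M`, with `g'` the derivative of `g`. -/
def SliceLE (η : ℝ) (g : X → Y) (g' : X → X →L[ℝ] Y) (M : ℝ) : Prop :=
  (∀ x, ‖g x‖ ≤ M) ∧ (∀ x, ‖g' x‖ ≤ M) ∧ ∀ x y, ‖g' x - g' y‖ ≤ M * ‖x - y‖ ^ η

/-- `A ∈ C^γ_t C^{1+η}_x` on `[0,T]²`, with norm at most `M`; `DA` is the spatial
derivative of `A`. -/
def MemCtC1 (T : ℝ) (γ : ℝ × ℝ) (η : ℝ)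
    (A : ℝ × ℝ → X → Y) (DA : ℝ × ℝ → X → X →L[ℝ] Y) (M : ℝ) : Prop :=
  (∀ t ∈ Sq T, ∀ x, HasFDerivAt (A t) (DA t x) x) ∧
  (∀ t ∈ Sq T, SliceLE η (A t) (DA t) M) ∧
  (∀ s ∈ Sq T, ∀ t ∈ Sq T,
    SliceLE η (fun x => A (t.1, s.2) x - A s x)
      (fun x => DA (t.1, s.2) x - DA s x) (M * |t.1 - s.1| ^ γ.1)) ∧
  (∀ s ∈ Sq T, ∀ t ∈ Sq T,
    SliceLE η (fun x => A (s.1, t.2) x - A s x)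
      (fun x => DA (s.1, t.2) x - DA s x) (M * |t.2 - s.2| ^ γ.2)) ∧
  (∀ s ∈ Sq T, ∀ t ∈ Sq T,
    SliceLE η (fun x => box (fun r => A r x) s t)
      (fun x => box (fun r => DA r x) s t) (M * mPow γ s t))

/-- `‖g‖_{C^{2+η}_b} ≤ M`, with `g'` and `g''` the first and second derivatives of `g`. -/
def Slice2LE (η : ℝ) (g : X → Y) (g' : X → X →L[ℝ] Y)
    (g'' : X → X →L[ℝ] X →L[ℝ] Y) (M : ℝ) : Prop :=
  (∀ x, ‖g x‖ ≤ M) ∧ (∀ x, ‖g' x‖ ≤ M) ∧ (∀ x, ‖g'' x‖ ≤ M) ∧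
    ∀ x y, ‖g'' x - g'' y‖ ≤ M * ‖x - y‖ ^ η

/-- `A ∈ C^γ_t C^{2+η}_x` on `[0,T]²`, with norm at most `M`; `DA`, `D2A` are the spatial
derivatives of `A`. -/
def MemCtC2 (T : ℝ) (γ : ℝ × ℝ) (η : ℝ) (A : ℝ × ℝ → X → Y)
    (DA : ℝ × ℝ → X → X →L[ℝ] Y) (D2A : ℝ × ℝ → X → X →L[ℝ] X →L[ℝ] Y)
    (M : ℝ) : Prop :=
  (∀ t ∈ Sq T, ∀ x, HasFDerivAt (A t) (DA t x) x) ∧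
  (∀ t ∈ Sq T, ∀ x, HasFDerivAt (DA t) (D2A t x) x) ∧
  (∀ t ∈ Sq T, Slice2LE η (A t) (DA t) (D2A t) M) ∧
  (∀ s ∈ Sq T, ∀ t ∈ Sq T,
    Slice2LE η (fun x => A (t.1, s.2) x - A s x)
      (fun x => DA (t.1, s.2) x - DA s x)
      (fun x => D2A (t.1, s.2) x - D2A s x) (M * |t.1 - s.1| ^ γ.1)) ∧
  (∀ s ∈ Sq T, ∀ t ∈ Sq T,
    Slice2LE η (fun x => A (s.1, t.2) x - A s x)
      (fun x => DA (s.1, t.2) x - DA s x)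
      (fun x => D2A (s.1, t.2) x - D2A s x) (M * |t.2 - s.2| ^ γ.2)) ∧
  (∀ s ∈ Sq T, ∀ t ∈ Sq T,
    Slice2LE η (fun x => box (fun r => A r x) s t)
      (fun x => box (fun r => DA r x) s t)
      (fun x => box (fun r => D2A r x) s t) (M * mPow γ s t))

/-- The germ `(s,t) ↦ □_{s,t} A(y_s)` of the 2D non-linear Young integral. -/
def nlyGerm (A : ℝ × ℝ → X → Y) (y : ℝ × ℝ → X) : ℝ × ℝ → ℝ × ℝ → Y :=
  fun s t => box (fun r => A r (y s)) s t



/-- Sewing constant. -/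
def kap (p : ℝ) : ℝ := 2 / (1 - (2:ℝ) ^ (1 - p))

lemma kap_aux {p : ℝ} (hp : 1 < p) : 0 < 1 - (2:ℝ) ^ (1 - p) := by
  have : (2:ℝ) ^ (1 - p) < 1 := Real.rpow_lt_one_of_one_lt_of_neg (by norm_num) (by linarith)
  linarith

lemma kap_pos {p : ℝ} (hp : 1 < p) : 0 < kap p := div_pos two_pos (kap_aux hp)

lemma kap_eq {p : ℝ} (hp : 1 < p) : kap p * (2 * (1/2:ℝ) ^ p) + 2 = kap p := by
  have h := kap_aux hp
  have e : 2 * (1/2:ℝ) ^ p = (2:ℝ) ^ (1 - p) := by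
    rw [Real.rpow_sub two_pos, Real.rpow_one, one_div, Real.inv_rpow (by norm_num)]
    ring
  rw [e]
  unfold kap
  field_simp
  ring

lemma sew1 {V : Type*} [NormedAddCommGroup V] {x : ℕ → ℝ} (hx : Monotone x) {g : ℕ → ℕ → V}
    {p C : ℝ} (hp : 1 < p) (hC : 0 ≤ C) : ∀ (n a b : ℕ), b - a ≤ n → a < b →
    (∀ i u k, a ≤ i → i < u → u < k → k ≤ b → ‖g i k - g i u - g u k‖ ≤ C * (x k - x i) ^ p) →
    ‖∑ i ∈ Finset.Ico a b, g i (i+1) - g a b‖ ≤ kap p * C * (x b - x a) ^ p := by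
  intro n
  induction n with
  | zero => intro a b h1 h2; omega
  | succ n ih =>
    intro a b hn hab H
    have hL : 0 ≤ x b - x a := sub_nonneg.2 (hx hab.le)
    have hk := kap_pos hp
    set L := x b - x a with hLdef
    have hLp : 0 ≤ L ^ p := Real.rpow_nonneg hL _
    -- the splitting index
    classical
    let Q : ℕ → Prop := fun j => a ≤ j ∧ j < b ∧ x j - x a ≤ L / 2
    have hQa : Q a := ⟨le_rfl, hab, by simp; linarith⟩
    obtain ⟨j, hj, hjmax⟩ : ∃ j, Q j ∧ ∀ j', Q j' → j' ≤ j := by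
      have := Nat.findGreatest_spec (P := Q) (n := b) hab.le hQa
      exact ⟨_, this, fun j' h => Nat.le_findGreatest h.2.1.le h⟩
    obtain ⟨haj, hjb, hjL⟩ := hj
    have hright : x b - x (j+1) ≤ L / 2 := by
      rcases Nat.lt_or_ge (j+1) b with h | h
      · by_contra hcon
        have : Q (j+1) := ⟨by omega, h, by rw [hLdef] at *; linarith⟩
        have := hjmax _ this
        omega
      · have : j + 1 = b := by omega
        rw [this]; simp; linarith
    have half : ∀ y, 0 ≤ y → y ≤ L / 2 → kap p * C * y ^ p ≤ kap p * C * ((1/2) ^ p * L ^ p) := by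
      intro y hy hyL
      rw [← Real.mul_rpow (by norm_num) hL]
      gcongr
      linarith
    have hsm : ∀ i k, a ≤ i → i ≤ k → k ≤ b → C * (x k - x i) ^ p ≤ C * L ^ p := by
      intro i k h1 h2 h3
      have e1 := hx h1
      have e2 := hx h2
      have e3 := hx h3
      have : 0 ≤ x k - x i := sub_nonneg.2 e2
      gcongr
      rw [hLdef]; linarith
    have hCL : 0 ≤ C * L ^ p := by positivity
    have key := kap_eq hp
    have key2 : kap p * C * L ^ p = 2 * (kap p * C * ((1/2) ^ p * L ^ p)) + 2 * (C * L ^ p) := by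
      nth_rewrite 1 [← key]; ring
    have hhalf0 : 0 ≤ kap p * C * ((1/2:ℝ) ^ p * L ^ p) := by positivity
    have left : a < j → ‖∑ i ∈ Finset.Ico a j, g i (i+1) - g a j‖
        ≤ kap p * C * ((1/2) ^ p * L ^ p) := by
      intro h
      refine (ih a j (by omega) h fun i u k h1 h2 h3 h4 => H i u k h1 h2 h3 (by omega)).trans ?_
      exact half _ (sub_nonneg.2 (hx haj)) hjL
    have right : j + 1 < b → ‖∑ i ∈ Finset.Ico (j+1) b, g i (i+1) - g (j+1) b‖
        ≤ kap p * C * ((1/2) ^ p * L ^ p) := by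
      intro h
      refine (ih (j+1) b (by omega) h fun i u k h1 h2 h3 h4 => H i u k (by omega) h2 h3 h4).trans ?_
      exact half _ (sub_nonneg.2 (hx hjb)) hright
    have split : ∑ i ∈ Finset.Ico a b, g i (i+1) = ∑ i ∈ Finset.Ico a j, g i (i+1) + g j (j+1)
        + ∑ i ∈ Finset.Ico (j+1) b, g i (i+1) := by
      rw [← Finset.sum_Ico_succ_top haj, Finset.sum_Ico_consecutive _ (by omega) (by omega)]
    rw [split, key2]
    rcases Nat.eq_or_lt_of_le haj with h1 | h1 <;> rcases Nat.eq_or_lt_of_le (Nat.succ_le_of_lt hjb) with h2 | h2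
    · subst h1
      subst h2
      simp
      linarith
    · subst h1
      have r := right h2
      have d := (H a (a+1) b le_rfl (by omega) h2 le_rfl).trans (hsm a b le_rfl hab.le le_rfl)
      have e : ∑ i ∈ Finset.Ico a a, g i (i+1) + g a (a+1) + ∑ i ∈ Finset.Ico (a+1) b, g i (i+1) - g a b
        = (∑ i ∈ Finset.Ico (a+1) b, g i (i+1) - g (a+1) b) - (g a b - g a (a+1) - g (a+1) b) := by
        simp; abel
      rw [e]
      refine (norm_sub_le _ _).trans ?_
      linarith
    · subst h2
      have r := left h1
      have d := (H a j (j+1) le_rfl h1 (by omega) le_rfl).trans (hsm a (j+1) le_rfl hab.le le_rfl)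
      have e : ∑ i ∈ Finset.Ico a j, g i (i+1) + g j (j+1)
          + ∑ i ∈ Finset.Ico (j+1) (j+1), g i (i+1) - g a (j+1)
        = (∑ i ∈ Finset.Ico a j, g i (i+1) - g a j) - (g a (j+1) - g a j - g j (j+1)) := by
        simp; abel
      rw [Nat.succ_eq_add_one, e]
      refine (norm_sub_le _ _).trans ?_
      linarith
    · have r := right h2
      have l := left h1
      have d := (H a j b le_rfl h1 hjb le_rfl).trans (hsm a b le_rfl hab.le le_rfl)
      have d' := (H j (j+1) b haj (by omega) h2 le_rfl).trans (hsm j b haj hjb.le le_rfl)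
      have e : ∑ i ∈ Finset.Ico a j, g i (i+1) + g j (j+1)
          + ∑ i ∈ Finset.Ico (j+1) b, g i (i+1) - g a b
        = (∑ i ∈ Finset.Ico a j, g i (i+1) - g a j) + (∑ i ∈ Finset.Ico (j+1) b, g i (i+1) - g (j+1) b)
          - (g a b - g a j - g j b) - (g j b - g j (j+1) - g (j+1) b) := by
        abel
      rw [e]
      refine (norm_sub_le _ _).trans ?_
      have := (norm_sub_le (∑ i ∈ Finset.Ico a j, g i (i+1) - g a j + (∑ i ∈ Finset.Ico (j+1) b, g i (i+1) - g (j+1) b)) (g a b - g a j - g j b))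
      have := (norm_add_le (∑ i ∈ Finset.Ico a j, g i (i+1) - g a j) (∑ i ∈ Finset.Ico (j+1) b, g i (i+1) - g (j+1) b))
      linarith

lemma sew1' {V : Type*} [NormedAddCommGroup V] {x : ℕ → ℝ} (hx : Monotone x) {g : ℕ → ℕ → V}
    {p C : ℝ} (hp : 1 < p) (hC : 0 ≤ C) {a b : ℕ} (hab : a ≤ b) (h0 : g a a = 0)
    (H : ∀ i u k, a ≤ i → i < u → u < k → k ≤ b →
      ‖g i k - g i u - g u k‖ ≤ C * (x k - x i) ^ p) :
    ‖∑ i ∈ Finset.Ico a b, g i (i+1) - g a b‖ ≤ kap p * C * (x b - x a) ^ p := by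
  rcases Nat.eq_or_lt_of_le hab with h | h
  · subst h
    simp [h0, Real.zero_rpow (by linarith : p ≠ 0)]
  · exact sew1 hx hp hC _ a b le_rfl h H

/-- 2D sewing estimate over an index rectangle. -/
lemma sew2 {V : Type*} [NormedAddCommGroup V] {x y : ℕ → ℝ} (hx : Monotone x) (hy : Monotone y)
    {G : ℕ → ℕ → ℕ → ℕ → V} {p1 p2 C1 C2 C12 : ℝ} (hp1 : 1 < p1) (hp2 : 1 < p2)
    (hC1 : 0 ≤ C1) (hC2 : 0 ≤ C2) (hC12 : 0 ≤ C12) {a b c d : ℕ} (hab : a < b) (hcd : c < d)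
    (H1 : ∀ i u k, a ≤ i → i < u → u < k → k ≤ b →
      ‖G i k c d - G i u c d - G u k c d‖ ≤ C1 * (x k - x i) ^ p1)
    (H2 : ∀ j v l, c ≤ j → j < v → v < l → l ≤ d →
      ‖G a b j l - G a b j v - G a b v l‖ ≤ C2 * (y l - y j) ^ p2)
    (H12 : ∀ i u k j v l, a ≤ i → i < u → u < k → k ≤ b → c ≤ j → j < v → v < l → l ≤ d →
      ‖(G i k j l - G i u j l - G u k j l) - (G i k j v - G i u j v - G u k j v)
        - (G i k v l - G i u v l - G u k v l)‖ ≤ C12 * (x k - x i) ^ p1 * (y l - y j) ^ p2) :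
    ‖∑ i ∈ Finset.Ico a b, ∑ j ∈ Finset.Ico c d, G i (i+1) j (j+1) - G a b c d‖ ≤
      kap p1 * (C1 + kap p2 * C12 * (y d - y c) ^ p2) * (x b - x a) ^ p1
        + kap p2 * C2 * (y d - y c) ^ p2 := by
  have k1 := kap_pos hp1
  have k2 := kap_pos hp2
  have hyp : 0 ≤ (y d - y c) ^ p2 := Real.rpow_nonneg (sub_nonneg.2 (hy hcd.le)) _
  have A1 : ‖∑ i ∈ Finset.Ico a b, (fun i k => ∑ j ∈ Finset.Ico c d, G i k j (j+1)) i (i+1)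
      - (fun i k => ∑ j ∈ Finset.Ico c d, G i k j (j+1)) a b‖ ≤
      kap p1 * (C1 + kap p2 * C12 * (y d - y c) ^ p2) * (x b - x a) ^ p1 := by
    refine sew1 hx (g := fun i k => ∑ j ∈ Finset.Ico c d, G i k j (j+1)) hp1 (by positivity) _ a b le_rfl hab ?_
    intro i u k h1 h2 h3 h4
    have hxp : 0 ≤ (x k - x i) ^ p1 := Real.rpow_nonneg (sub_nonneg.2 (hx (by omega))) _
    have := sew1 hy (g := fun j l => G i k j l - G i u j l - G u k j l) hp2
      (C := C12 * (x k - x i) ^ p1) (by positivity) _ c d le_rfl hcd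
      (fun j v l h5 h6 h7 h8 => H12 i u k j v l h1 h2 h3 h4 h5 h6 h7 h8)
    have e := H1 i u k h1 h2 h3 h4
    simp only [← Finset.sum_sub_distrib]
    have t := norm_le_norm_add_norm_sub (G i k c d - G i u c d - G u k c d)
      (∑ j ∈ Finset.Ico c d, (G i k j (j+1) - G i u j (j+1) - G u k j (j+1)))
    have t' := norm_sub_rev (G i k c d - G i u c d - G u k c d)
      (∑ j ∈ Finset.Ico c d, (G i k j (j+1) - G i u j (j+1) - G u k j (j+1)))
    nlinarith [t, t', e, this]
  have A2 := sew1 hy (g := fun j l => G a b j l) hp2 hC2 _ c d le_rfl hcd H2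
  have e : ∑ i ∈ Finset.Ico a b, ∑ j ∈ Finset.Ico c d, G i (i+1) j (j+1) - G a b c d
    = (∑ i ∈ Finset.Ico a b, (fun i k => ∑ j ∈ Finset.Ico c d, G i k j (j+1)) i (i+1)
      - (fun i k => ∑ j ∈ Finset.Ico c d, G i k j (j+1)) a b) +
      (∑ j ∈ Finset.Ico c d, (fun j l => G a b j l) j (j+1) - (fun j l => G a b j l) c d) := by
    simp
  rw [e]
  exact (norm_add_le _ _).trans (add_le_add A1 A2)

lemma coarse1 {V : Type*} [NormedAddCommGroup V] {x : ℕ → ℝ} (hx : Monotone x) {g : ℕ → ℕ → V}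
    {p C : ℝ} (hp : 1 < p) (hC : 0 ≤ C) {α : ℕ → ℕ} (hα : Monotone α) (hα0 : α 0 = 0)
    (h0 : ∀ i, g i i = 0) : ∀ n : ℕ,
    (∀ i u k, i ≤ u → u ≤ k → k ≤ α n →
      ‖g i k - g i u - g u k‖ ≤ C * (x k - x i) ^ p) →
    ‖∑ i ∈ Finset.range (α n), g i (i+1) - ∑ i ∈ Finset.range n, g (α i) (α (i+1))‖
      ≤ kap p * C * ∑ i ∈ Finset.range n, (x (α (i+1)) - x (α i)) ^ p := by
  intro n
  induction n with
  | zero => intro H; simp [hα0]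
  | succ n ih =>
    intro H
    have hn := hα (Nat.le_succ n)
    have i1 := ih fun i u k h1 h2 h3 => H i u k h1 h2 (h3.trans hn)
    have i2 := sew1' hx hp hC hn (h0 _) fun i u k h1 h2 h3 h4 => H i u k h2.le h3.le h4
    rw [Finset.sum_range_succ, Finset.sum_range_succ, mul_add,
      ← Finset.sum_range_add_sum_Ico (fun i => g i (i+1)) hn]
    refine le_trans ?_ (add_le_add i1 i2)
    refine le_trans (le_of_eq ?_) (norm_add_le _ _)
    congr 1
    simp only [Nat.succ_eq_add_one]
    abel

lemma coarse2 {V : Type*} [NormedAddCommGroup V] {x y : ℕ → ℝ} (hx : Monotone x) (hy : Monotone y)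
    {G : ℕ → ℕ → ℕ → ℕ → V} {p1 p2 C1 C2 C12 : ℝ} (hp1 : 1 < p1) (hp2 : 1 < p2)
    (hC1 : 0 ≤ C1) (hC2 : 0 ≤ C2) (hC12 : 0 ≤ C12)
    {α β : ℕ → ℕ} (hα : Monotone α) (hα0 : α 0 = 0) (hβ : Monotone β) (hβ0 : β 0 = 0) (n m : ℕ)
    (G01 : ∀ i j l, G i i j l = 0) (G02 : ∀ i k j, G i k j j = 0)
    (H1 : ∀ i u k, i ≤ u → u ≤ k → k ≤ α n →
      ‖G i k 0 (β m) - G i u 0 (β m) - G u k 0 (β m)‖ ≤ C1 * (x k - x i) ^ p1)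
    (H2 : ∀ j v l, j ≤ v → v ≤ l → l ≤ β m →
      ‖G 0 (α n) j l - G 0 (α n) j v - G 0 (α n) v l‖ ≤ C2 * (y l - y j) ^ p2)
    (H12 : ∀ i u k j v l, i ≤ u → u ≤ k → k ≤ α n → j ≤ v → v ≤ l → l ≤ β m →
      ‖(G i k j l - G i u j l - G u k j l) - (G i k j v - G i u j v - G u k j v)
        - (G i k v l - G i u v l - G u k v l)‖ ≤ C12 * (x k - x i) ^ p1 * (y l - y j) ^ p2) :
    ‖∑ i ∈ Finset.range (α n), ∑ j ∈ Finset.range (β m), G i (i+1) j (j+1)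
      - ∑ i ∈ Finset.range n, ∑ j ∈ Finset.range m, G (α i) (α (i+1)) (β j) (β (j+1))‖ ≤
      kap p1 * (C1 + kap p2 * C12 * (y (β m) - y 0) ^ p2)
          * ∑ i ∈ Finset.range n, (x (α (i+1)) - x (α i)) ^ p1
        + kap p2 * (C2 + kap p1 * C12 * (x (α n) - x 0) ^ p1)
          * ∑ j ∈ Finset.range m, (y (β (j+1)) - y (β j)) ^ p2 := by
  have k1 := kap_pos hp1
  have k2 := kap_pos hp2
  have hyp : 0 ≤ (y (β m) - y 0) ^ p2 := Real.rpow_nonneg (sub_nonneg.2 (hy (Nat.zero_le _))) _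
  have hxp : 0 ≤ (x (α n) - x 0) ^ p1 := Real.rpow_nonneg (sub_nonneg.2 (hx (Nat.zero_le _))) _
  have A1 := coarse1 hx (g := fun i k => ∑ j ∈ Finset.range (β m), G i k j (j+1)) hp1
    (C := C1 + kap p2 * C12 * (y (β m) - y 0) ^ p2) (by positivity) hα hα0
    (fun i => by simp [G01]) n (by
    intro i u k h2 h3 h4
    have hxp : 0 ≤ (x k - x i) ^ p1 := Real.rpow_nonneg (sub_nonneg.2 (hx (by omega))) _
    have := sew1' hy (g := fun j l => G i k j l - G i u j l - G u k j l) hp2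
      (C := C12 * (x k - x i) ^ p1) (by positivity) (Nat.zero_le (β m)) (by simp [G02])
      (fun j v l h5 h6 h7 h8 => H12 i u k j v l h2 h3 h4 h6.le h7.le h8)
    have e := H1 i u k h2 h3 h4
    simp only [← Finset.sum_sub_distrib]
    rw [← Finset.range_eq_Ico] at this
    have t := norm_le_norm_add_norm_sub (G i k 0 (β m) - G i u 0 (β m) - G u k 0 (β m))
      (∑ j ∈ Finset.range (β m), (G i k j (j+1) - G i u j (j+1) - G u k j (j+1)))
    have t' := norm_sub_rev (G i k 0 (β m) - G i u 0 (β m) - G u k 0 (β m))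
      (∑ j ∈ Finset.range (β m), (G i k j (j+1) - G i u j (j+1) - G u k j (j+1)))
    nlinarith [t, t', e, this])
  have A2 := coarse1 hy (g := fun j l => ∑ i ∈ Finset.range n, G (α i) (α (i+1)) j l) hp2
    (C := C2 + kap p1 * C12 * (x (α n) - x 0) ^ p1) (by positivity) hβ hβ0
    (fun i => by simp [G02]) m (by
    intro j v l h2 h3 h4
    have hyp : 0 ≤ (y l - y j) ^ p2 := Real.rpow_nonneg (sub_nonneg.2 (hy (by omega))) _
    have := sew1' (hx.comp hα) (g := fun i k => G (α i) (α k) j l - G (α i) (α k) j v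
      - G (α i) (α k) v l) hp1
      (C := C12 * (y l - y j) ^ p2) (by positivity) (Nat.zero_le n) (by simp [G01])
      (fun i u k h5 h6 h7 h8 => by
        have := H12 (α i) (α u) (α k) j v l (hα h6.le) (hα h7.le) (hα h8) h2 h3 h4
        refine le_trans (le_of_eq ?_) (this.trans (le_of_eq ?_))
        · congr 1; abel
        · simp only [Function.comp]; ring)
    have e := H2 j v l h2 h3 h4
    simp only [← Finset.sum_sub_distrib]
    rw [← Finset.range_eq_Ico] at this
    simp only [Function.comp, hα0] at this
    have t := norm_le_norm_add_norm_sub (G 0 (α n) j l - G 0 (α n) j v - G 0 (α n) v l)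
      (∑ i ∈ Finset.range n, (G (α i) (α (i+1)) j l - G (α i) (α (i+1)) j v - G (α i) (α (i+1)) v l))
    have t' := norm_sub_rev (G 0 (α n) j l - G 0 (α n) j v - G 0 (α n) v l)
      (∑ i ∈ Finset.range n, (G (α i) (α (i+1)) j l - G (α i) (α (i+1)) j v - G (α i) (α (i+1)) v l))
    nlinarith [t, t', e, this])
  refine le_trans ?_ (add_le_add A1 A2)
  refine le_trans (le_of_eq ?_) (norm_add_le _ _)
  congr 1
  rw [Finset.sum_comm (s := Finset.range n) (t := Finset.range m),
    Finset.sum_comm (s := Finset.range n) (t := Finset.range (β m))]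
  abel



lemma lip_of_fderiv {V W : Type*} [NormedAddCommGroup V] [NormedSpace ℝ V]
    [NormedAddCommGroup W] [NormedSpace ℝ W] {f : V → W} {f' : V → V →L[ℝ] W} {m : ℝ}
    (h : ∀ z, HasFDerivAt f (f' z) z) (hb : ∀ z, ‖f' z‖ ≤ m) (a b : V) :
    ‖f a - f b‖ ≤ m * ‖a - b‖ :=
  convex_univ.norm_image_sub_le_of_norm_hasFDerivWithin_le
    (fun z _ => (h z).hasFDerivWithinAt) (fun z _ => hb z) (mem_univ b) (mem_univ a)

lemma four_point {V W : Type*} [NormedAddCommGroup V] [NormedSpace ℝ V]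
    [NormedAddCommGroup W] [NormedSpace ℝ W] {f : V → W} {f' : V → V →L[ℝ] W} {m η : ℝ}
    (h : ∀ z, HasFDerivAt f (f' z) z) (hb : ∀ z, ‖f' z‖ ≤ m)
    (hh : ∀ z z', ‖f' z - f' z'‖ ≤ m * ‖z - z'‖ ^ η) (a b c d : V) :
    ‖f a - f b - f c + f d‖ ≤ m * (‖a - b - c + d‖ + ‖c - d‖ ^ η * ‖b - d‖) := by
  have h1 := lip_of_fderiv h hb a (b + (c - d))
  have h2 := lip_of_fderiv (f := fun z => f (z + (c - d)) - f z)
    (f' := fun z => f' (z + (c - d)) - f' z) (m := m * ‖c - d‖ ^ η)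
    (fun z => by
      refine HasFDerivAt.sub ?_ (h z)
      simpa [Function.comp_def] using (h (z + (c - d))).comp z ((hasFDerivAt_id z).add_const (c - d)))
    (fun z => by simpa using hh (z + (c - d)) z) b d
  have e : f a - f b - f c + f d = (f a - f (b + (c - d))) +
      ((f (b + (c - d)) - f b) - (f (d + (c - d)) - f d)) := by
    rw [add_sub_cancel]; abel
  have e2 : a - b - c + d = a - (b + (c - d)) := by abel
  rw [e, e2, mul_add]
  refine (norm_add_le _ _).trans (add_le_add h1 (h2.trans (le_of_eq (by ring))))

/-- `F ∈ C^{2+η}` with constant `m`. -/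
structure C2F {V W : Type*} [NormedAddCommGroup V] [NormedSpace ℝ V]
    [NormedAddCommGroup W] [NormedSpace ℝ W] (η m : ℝ) (F : V → W) (F' : V → V →L[ℝ] W)
    (F'' : V → V →L[ℝ] V →L[ℝ] W) : Prop where
  h1 : ∀ z, HasFDerivAt F (F' z) z
  h2 : ∀ z, HasFDerivAt F' (F'' z) z
  b0 : ∀ z, ‖F z‖ ≤ m
  b1 : ∀ z, ‖F' z‖ ≤ m
  b2 : ∀ z, ‖F'' z‖ ≤ m
  b3 : ∀ z z', ‖F'' z - F'' z'‖ ≤ m * ‖z - z'‖ ^ η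

section c2f
variable {V W : Type*} [NormedAddCommGroup V] [NormedSpace ℝ V]
    [NormedAddCommGroup W] [NormedSpace ℝ W] {η m : ℝ} {F : V → W} {F' : V → V →L[ℝ] W}
    {F'' : V → V →L[ℝ] V →L[ℝ] W}

lemma C2F.nonneg (h : C2F η m F F' F'') : 0 ≤ m := (norm_nonneg _).trans (h.b0 0)

lemma C2F.lip (h : C2F η m F F' F'') (a b : V) : ‖F a - F b‖ ≤ m * ‖a - b‖ :=
  lip_of_fderiv h.h1 h.b1 a b

lemma C2F.four (h : C2F η m F F' F'') (a b c d : V) :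
    ‖F a - F b - F c + F d‖ ≤ m * (‖a - b - c + d‖ + ‖c - d‖ * ‖b - d‖) := by
  have := four_point (η := 1) h.h1 h.b1
    (fun z z' => by rw [Real.rpow_one]; exact lip_of_fderiv h.h2 h.b2 z z') a b c d
  rwa [Real.rpow_one] at this

lemma convex_norm_le {V : Type*} [NormedAddCommGroup V] [NormedSpace ℝ V] {u v : V} {P τ : ℝ}
    (hτ : τ ∈ Icc (0:ℝ) 1) (hu : ‖u‖ ≤ P) (hv : ‖v‖ ≤ P) : ‖v + τ • (u - v)‖ ≤ P := by
  have e : v + τ • (u - v) = (1 - τ) • v + τ • u := by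
    rw [smul_sub, sub_smul, one_smul]; abel
  rw [e]
  have h1 := hτ.1
  have h2 : 0 ≤ 1 - τ := by linarith [hτ.2]
  refine (norm_add_le _ _).trans ?_
  rw [norm_smul, norm_smul, Real.norm_of_nonneg h1, Real.norm_of_nonneg h2]
  nlinarith

lemma C2F.eight (h : C2F η m F F' F'') (hη : 0 ≤ η) {P1 P2 P12 : ℝ} {a b c d a' b' c' d' : V}
    (hab : ‖a - b‖ ≤ P1) (hab' : ‖a' - b'‖ ≤ P1) (hcd : ‖c - d‖ ≤ P1) (hcd' : ‖c' - d'‖ ≤ P1)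
    (hac : ‖a - c‖ ≤ P2) (hac' : ‖a' - c'‖ ≤ P2) (hbd : ‖b - d‖ ≤ P2) (hbd' : ‖b' - d'‖ ≤ P2)
    (hq : ‖a - b - c + d‖ ≤ P12) (hq' : ‖a' - b' - c' + d'‖ ≤ P12) :
    ‖(F a - F b - F c + F d) - (F a' - F b' - F c' + F d')‖ ≤
      m * (‖(a - a') - (b - b') - (c - c') + (d - d')‖ + P1 * ‖(b - b') - (d - d')‖
        + P2 * ‖(c - c') - (d - d')‖ + (P12 + P1 ^ η * P2) * ‖d - d'‖) := by
  have hm := h.nonneg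
  have hP1 : 0 ≤ P1 := (norm_nonneg _).trans hab
  have hP2 : 0 ≤ P2 := (norm_nonneg _).trans hac
  have hD : ∀ u u' : V, ∀ τ : ℝ, HasDerivAt (fun τ : ℝ => F (u' + τ • (u - u')))
      (F' (u' + τ • (u - u')) (u - u')) τ := by
    intro u u' τ
    have : HasDerivAt (fun τ : ℝ => u' + τ • (u - u')) (u - u') τ := by
      simpa using ((hasDerivAt_id τ).smul_const (u - u')).const_add u'
    exact (h.h1 _).comp_hasDerivAt τ this
  let ψ : ℝ → W := fun τ => F (a' + τ • (a - a')) - F (b' + τ • (b - b'))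
    - F (c' + τ • (c - c')) + F (d' + τ • (d - d'))
  have hψ : ∀ τ, HasDerivAt ψ _ τ := fun τ =>
    (((hD a a' τ).sub (hD b b' τ)).sub (hD c c' τ)).add (hD d d' τ)
  have key := norm_image_sub_le_of_norm_deriv_le_segment_01' (f := ψ)
    (C := m * (‖(a - a') - (b - b') - (c - c') + (d - d')‖ + P1 * ‖(b - b') - (d - d')‖
        + P2 * ‖(c - c') - (d - d')‖ + (P12 + P1 ^ η * P2) * ‖d - d'‖))
    (fun τ _ => (hψ τ).hasDerivWithinAt) ?_
  · simpa [ψ] using key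
  intro τ hτ'
  have hτ : τ ∈ Icc (0:ℝ) 1 := ⟨hτ'.1, hτ'.2.le⟩
  set A := a' + τ • (a - a') with hA
  set B := b' + τ • (b - b') with hB
  set C := c' + τ • (c - c') with hC
  set D := d' + τ • (d - d') with hDD
  have eAB : ‖A - B‖ ≤ P1 := by
    have : A - B = (a' - b') + τ • ((a - b) - (a' - b')) := by
      rw [hA, hB]; simp only [smul_sub]; abel
    rw [this]; exact convex_norm_le hτ hab hab'
  have eCD : ‖C - D‖ ≤ P1 := by
    have : C - D = (c' - d') + τ • ((c - d) - (c' - d')) := by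
      rw [hC, hDD]; simp only [smul_sub]; abel
    rw [this]; exact convex_norm_le hτ hcd hcd'
  have eAC : ‖A - C‖ ≤ P2 := by
    have : A - C = (a' - c') + τ • ((a - c) - (a' - c')) := by
      rw [hA, hC]; simp only [smul_sub]; abel
    rw [this]; exact convex_norm_le hτ hac hac'
  have eBD : ‖B - D‖ ≤ P2 := by
    have : B - D = (b' - d') + τ • ((b - d) - (b' - d')) := by
      rw [hB, hDD]; simp only [smul_sub]; abel
    rw [this]; exact convex_norm_le hτ hbd hbd'
  have eQ : ‖A - B - C + D‖ ≤ P12 := by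
    have : A - B - C + D = (a' - b' - c' + d') + τ • ((a - b - c + d) - (a' - b' - c' + d')) := by
      rw [hA, hB, hC, hDD]; simp only [smul_sub, smul_add]; abel
    rw [this]; exact convex_norm_le hτ hq hq'
  have e : F' A (a - a') - F' B (b - b') - F' C (c - c') + F' D (d - d')
      = F' A ((a - a') - (b - b') - (c - c') + (d - d')) + (F' A - F' B) ((b - b') - (d - d'))
        + (F' A - F' C) ((c - c') - (d - d')) + (F' A - F' B - F' C + F' D) (d - d') := by
    simp only [map_add, map_sub, _root_.sub_apply, _root_.add_apply]
    abel
  rw [e]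
  have t1 := ((F' A).le_opNorm ((a - a') - (b - b') - (c - c') + (d - d'))).trans
    (mul_le_mul_of_nonneg_right (h.b1 A) (norm_nonneg _))
  have t2 := ((F' A - F' B).le_opNorm ((b - b') - (d - d'))).trans
    (mul_le_mul_of_nonneg_right ((lip_of_fderiv h.h2 h.b2 A B).trans
      (mul_le_mul_of_nonneg_left eAB hm)) (norm_nonneg _))
  have t3 := ((F' A - F' C).le_opNorm ((c - c') - (d - d'))).trans
    (mul_le_mul_of_nonneg_right ((lip_of_fderiv h.h2 h.b2 A C).trans
      (mul_le_mul_of_nonneg_left eAC hm)) (norm_nonneg _))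
  have t4' : ‖F' A - F' B - F' C + F' D‖ ≤ m * (P12 + P1 ^ η * P2) := by
    refine (four_point h.h2 h.b2 h.b3 A B C D).trans ?_
    gcongr
  have t4 := ((F' A - F' B - F' C + F' D).le_opNorm (d - d')).trans
    (mul_le_mul_of_nonneg_right t4' (norm_nonneg _))
  refine (norm_add_le _ _).trans ?_
  refine (add_le_add_left ((norm_add_le _ _).trans (add_le_add_left (norm_add_le _ _) _)) _).trans ?_
  linarith [t1, t2, t3, t4]

end c2f

/-- A family of maps indexed by index rectangles, additive and `C^{2+η}`-bounded. -/
structure GermFam {V : Type*} [NormedAddCommGroup V] [NormedSpace ℝ V] (η g1 g2 M : ℝ)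
    (x y : ℕ → ℝ) (Φ : ℕ → ℕ → ℕ → ℕ → V → V) : Prop where
  add1 : ∀ i u k j l z, Φ i k j l z = Φ i u j l z + Φ u k j l z
  add2 : ∀ i k j v l z, Φ i k j l z = Φ i k j v z + Φ i k v l z
  reg : ∀ i k j l, i ≤ k → j ≤ l → ∃ F' F'',
    C2F η (M * ((x k - x i) ^ g1 * (y l - y j) ^ g2)) (Φ i k j l) F' F''

lemma germFam_of {V : Type*} [NormedAddCommGroup V] [NormedSpace ℝ V] {T : ℝ} {γ : ℝ × ℝ} {η M : ℝ}
    {A : ℝ × ℝ → V → V} {DA : ℝ × ℝ → V → V →L[ℝ] V} {D2A : ℝ × ℝ → V → V →L[ℝ] V →L[ℝ] V}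
    (hA : MemCtC2 T γ η A DA D2A M) {x y : ℕ → ℝ} (hx : Monotone x) (hy : Monotone y)
    (hxT : ∀ i, x i ∈ Icc 0 T) (hyT : ∀ i, y i ∈ Icc 0 T) :
    GermFam η γ.1 γ.2 M x y
      (fun i k j l z => box (fun r => A r z) (x i, y j) (x k, y l)) := by
  obtain ⟨h1, h2, -, -, -, h3⟩ := hA
  have hm : ∀ i j, (x i, y j) ∈ Sq T := fun i j =>
    ⟨⟨(hxT i).1, (hyT j).1⟩, ⟨(hxT i).2, (hyT j).2⟩⟩
  refine ⟨?_, ?_, ?_⟩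
  · intros; simp only [box]; abel
  · intros; simp only [box]; abel
  · intro i k j l hik hjl
    refine ⟨fun z => box (fun r => DA r z) (x i, y j) (x k, y l),
      fun z => box (fun r => D2A r z) (x i, y j) (x k, y l), ?_⟩
    obtain ⟨b0, b1, b2, b3⟩ := h3 _ (hm i j) _ (hm k l)
    have e : mPow γ (x i, y j) (x k, y l) = (x k - x i) ^ γ.1 * (y l - y j) ^ γ.2 := by
      simp only [mPow]
      rw [abs_of_nonneg (sub_nonneg.2 (hx hik)), abs_of_nonneg (sub_nonneg.2 (hy hjl))]
    rw [e] at b0 b1 b2 b3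
    refine ⟨fun z => ?_, fun z => ?_, b0, b1, b2, b3⟩
    · exact (((h1 _ (hm k l) z).sub (h1 _ (hm k j) z)).sub (h1 _ (hm i l) z)).add (h1 _ (hm i j) z)
    · exact (((h2 _ (hm k l) z).sub (h2 _ (hm k j) z)).sub (h2 _ (hm i l) z)).add (h2 _ (hm i j) z)



section germ
variable {V : Type*} [NormedAddCommGroup V] [NormedSpace ℝ V] {η g1 g2 M : ℝ}
  {x y : ℕ → ℝ} {Φ : ℕ → ℕ → ℕ → ℕ → V → V} {θ : ℕ → ℕ → V}

lemma GermFam.d1_eq (hΦ : GermFam η g1 g2 M x y Φ) (i u k j l : ℕ) :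
    Φ i k j l (θ i j) - Φ i u j l (θ i j) - Φ u k j l (θ u j)
      = Φ u k j l (θ i j) - Φ u k j l (θ u j) := by
  rw [hΦ.add1 i u k j l (θ i j)]; abel

lemma GermFam.d2_eq (hΦ : GermFam η g1 g2 M x y Φ) (i k j v l : ℕ) :
    Φ i k j l (θ i j) - Φ i k j v (θ i j) - Φ i k v l (θ i v)
      = Φ i k v l (θ i j) - Φ i k v l (θ i v) := by
  rw [hΦ.add2 i k j v l (θ i j)]; abel

lemma GermFam.d12_eq (hΦ : GermFam η g1 g2 M x y Φ) (i u k j v l : ℕ) :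
    (Φ i k j l (θ i j) - Φ i u j l (θ i j) - Φ u k j l (θ u j))
      - (Φ i k j v (θ i j) - Φ i u j v (θ i j) - Φ u k j v (θ u j))
      - (Φ i k v l (θ i v) - Φ i u v l (θ i v) - Φ u k v l (θ u v))
      = Φ u k v l (θ i j) - Φ u k v l (θ u j) - Φ u k v l (θ i v) + Φ u k v l (θ u v) := by
  rw [hΦ.d1_eq, hΦ.d1_eq, hΦ.d1_eq, hΦ.add2 u k j v l (θ i j), hΦ.add2 u k j v l (θ u j)]; abel

lemma GermFam.zero1 (hΦ : GermFam η g1 g2 M x y Φ) (i j l : ℕ) (z : V) : Φ i i j l z = 0 := by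
  have := hΦ.add1 i i i j l z
  simpa using this

lemma GermFam.zero2 (hΦ : GermFam η g1 g2 M x y Φ) (i k j : ℕ) (z : V) : Φ i k j j z = 0 := by
  have := hΦ.add2 i k j j j z
  simpa using this

lemma rpow_two_mul {a g : ℝ} (ha : 0 ≤ a) (hg : 0 ≤ g) : a ^ (2 * g) = a ^ g * a ^ g := by
  rw [two_mul, Real.rpow_add_of_nonneg ha hg hg]

lemma rpow_mono' {x : ℕ → ℝ} (hx : Monotone x) {g : ℝ} (hg : 0 ≤ g) {i u k l : ℕ} (h1 : i ≤ u)
    (h2 : u ≤ k) (h3 : k ≤ l) : (x k - x u) ^ g ≤ (x l - x i) ^ g := by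
  have e1 := hx h1
  have e2 := hx h2
  have e3 := hx h3
  exact Real.rpow_le_rpow (by linarith) (by linarith) hg

lemma rpow_nn {x : ℕ → ℝ} (hx : Monotone x) {g : ℝ} {i k : ℕ} (h1 : i ≤ k) : 0 ≤ (x k - x i) ^ g :=
  Real.rpow_nonneg (sub_nonneg.2 (hx h1)) _

lemma GermFam.d1_le (hΦ : GermFam η g1 g2 M x y Φ) (hx : Monotone x) (hy : Monotone y) (hM : 0 ≤ M)
    (hg1 : 0 ≤ g1) {K1 : ℝ} {i u k j l : ℕ} (h1 : i ≤ u) (h2 : u ≤ k) (h3 : j ≤ l)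
    (hK1 : 0 ≤ K1) (hK : ‖θ u j - θ i j‖ ≤ K1 * (x u - x i) ^ g1) :
    ‖Φ i k j l (θ i j) - Φ i u j l (θ i j) - Φ u k j l (θ u j)‖
      ≤ M * K1 * (y l - y j) ^ g2 * (x k - x i) ^ (2 * g1) := by
  rw [hΦ.d1_eq]
  obtain ⟨F', F'', h⟩ := hΦ.reg u k j l h2 h3
  have a1 := rpow_mono' hx hg1 le_rfl h1 h2
  have a2 := rpow_mono' hx hg1 h1 h2 le_rfl
  have n1 := rpow_nn hx (g := g1) h1
  have n2 := rpow_nn hx (g := g1) h2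
  have n3 := rpow_nn hx (g := g1) (h1.trans h2)
  have n4 := rpow_nn hy (g := g2) h3
  rw [rpow_two_mul (sub_nonneg.2 (hx (h1.trans h2))) hg1]
  rw [norm_sub_rev] at hK
  calc _ ≤ _ := h.lip _ _
    _ ≤ M * ((x k - x i) ^ g1 * (y l - y j) ^ g2) * (K1 * (x k - x i) ^ g1) := by
      gcongr
      exact hK.trans (by gcongr)
    _ = _ := by ring

lemma GermFam.d2_le (hΦ : GermFam η g1 g2 M x y Φ) (hx : Monotone x) (hy : Monotone y) (hM : 0 ≤ M)
    (hg2 : 0 ≤ g2) {K2 : ℝ} {i k j v l : ℕ} (h1 : j ≤ v) (h2 : v ≤ l) (h3 : i ≤ k)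
    (hK2 : 0 ≤ K2) (hK : ‖θ i v - θ i j‖ ≤ K2 * (y v - y j) ^ g2) :
    ‖Φ i k j l (θ i j) - Φ i k j v (θ i j) - Φ i k v l (θ i v)‖
      ≤ M * K2 * (x k - x i) ^ g1 * (y l - y j) ^ (2 * g2) := by
  rw [hΦ.d2_eq]
  obtain ⟨F', F'', h⟩ := hΦ.reg i k v l h3 h2
  have a1 := rpow_mono' hy hg2 le_rfl h1 h2
  have a2 := rpow_mono' hy hg2 h1 h2 le_rfl
  have n1 := rpow_nn hy (g := g2) h1
  have n2 := rpow_nn hy (g := g2) h2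
  have n3 := rpow_nn hy (g := g2) (h1.trans h2)
  have n4 := rpow_nn hx (g := g1) h3
  rw [rpow_two_mul (sub_nonneg.2 (hy (h1.trans h2))) hg2]
  rw [norm_sub_rev] at hK
  calc _ ≤ _ := h.lip _ _
    _ ≤ M * ((x k - x i) ^ g1 * (y l - y j) ^ g2) * (K2 * (y l - y j) ^ g2) := by
      gcongr
      exact hK.trans (by gcongr)
    _ = _ := by ring

lemma GermFam.d12_le (hΦ : GermFam η g1 g2 M x y Φ) (hx : Monotone x) (hy : Monotone y)
    (hM : 0 ≤ M) (hg1 : 0 ≤ g1) (hg2 : 0 ≤ g2) {K1 K2 K12 : ℝ} {i u k j v l : ℕ}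
    (h1 : i ≤ u) (h2 : u ≤ k) (h3 : j ≤ v) (h4 : v ≤ l)
    (hK1 : 0 ≤ K1) (hK2 : 0 ≤ K2) (hK12 : 0 ≤ K12)
    (hk1 : ‖θ u v - θ i v‖ ≤ K1 * (x u - x i) ^ g1)
    (hk2 : ‖θ u v - θ u j‖ ≤ K2 * (y v - y j) ^ g2)
    (hk12 : ‖θ u v - θ u j - θ i v + θ i j‖ ≤ K12 * (x u - x i) ^ g1 * (y v - y j) ^ g2) :
    ‖(Φ i k j l (θ i j) - Φ i u j l (θ i j) - Φ u k j l (θ u j))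
      - (Φ i k j v (θ i j) - Φ i u j v (θ i j) - Φ u k j v (θ u j))
      - (Φ i k v l (θ i v) - Φ i u v l (θ i v) - Φ u k v l (θ u v))‖
      ≤ M * (K12 + K1 * K2) * (x k - x i) ^ (2 * g1) * (y l - y j) ^ (2 * g2) := by
  rw [hΦ.d12_eq]
  obtain ⟨F', F'', h⟩ := hΦ.reg u k v l h2 h4
  have a1 := rpow_mono' hx hg1 le_rfl h1 h2
  have a2 := rpow_mono' hx hg1 h1 h2 le_rfl
  have n1 := rpow_nn hx (g := g1) h1
  have n2 := rpow_nn hx (g := g1) h2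
  have n3 := rpow_nn hx (g := g1) (h1.trans h2)
  have a1' := rpow_mono' hy hg2 le_rfl h3 h4
  have a2' := rpow_mono' hy hg2 h3 h4 le_rfl
  have n1' := rpow_nn hy (g := g2) h3
  have n2' := rpow_nn hy (g := g2) h4
  have n3' := rpow_nn hy (g := g2) (h3.trans h4)
  rw [rpow_two_mul (sub_nonneg.2 (hy (h3.trans h4))) hg2,
    rpow_two_mul (sub_nonneg.2 (hx (h1.trans h2))) hg1]
  rw [norm_sub_rev] at hk1 hk2
  have e : θ u v - θ u j - θ i v + θ i j = θ i j - θ u j - θ i v + θ u v := by abel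
  rw [e] at hk12
  have hk1' : ‖θ i v - θ u v‖ ≤ K1 * (x k - x i) ^ g1 := hk1.trans (by gcongr)
  have hk2' : ‖θ u j - θ u v‖ ≤ K2 * (y l - y j) ^ g2 := hk2.trans (by gcongr)
  have hk12' : ‖θ i j - θ u j - θ i v + θ u v‖ ≤ K12 * (x k - x i) ^ g1 * (y l - y j) ^ g2 :=
    hk12.trans (by gcongr)
  calc _ ≤ _ := h.four _ _ _ _
    _ ≤ M * ((x k - x i) ^ g1 * (y l - y j) ^ g2) *
      (K12 * (x k - x i) ^ g1 * (y l - y j) ^ g2 + (K1 * (x k - x i) ^ g1) * (K2 * (y l - y j) ^ g2)) := by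
      gcongr
    _ = _ := by ring

lemma chop {V : Type*} [NormedAddCommGroup V] {y : ℕ → ℝ} (hy : Monotone y) {f : ℕ → V} {m v : ℕ}
    {c g : ℝ} (hc : 0 ≤ c) (hg : 0 ≤ g)
    (H : ∀ j l, j ≤ l → l ≤ v → l ≤ j + m → ‖f l - f j‖ ≤ c * (y l - y j) ^ g) :
    ∀ r j l : ℕ, j ≤ l → l ≤ v → l ≤ j + r * m → ‖f l - f j‖ ≤ r * c * (y l - y j) ^ g := by
  intro r
  induction r with
  | zero =>
    intro j l h1 h2 h3
    have : j = l := by omega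
    subst this
    simp
  | succ r ih =>
    intro j l h1 h2 h3
    have e1 := ih j (min l (j + r * m)) (by omega) (by omega) (by omega)
    have e2 := H (min l (j + r * m)) l (by omega) h2 (by
      rw [Nat.succ_mul] at h3
      omega)
    set w := min l (j + r * m)
    have hw1 : j ≤ w := by omega
    have hw2 : w ≤ l := by omega
    have a1 := rpow_mono' hy hg le_rfl hw1 hw2
    have a2 := rpow_mono' hy hg hw1 hw2 le_rfl
    have e : f l - f j = (f l - f w) + (f w - f j) := by abel
    rw [e]
    push_cast
    calc _ ≤ _ := norm_add_le _ _
      _ ≤ c * (y l - y j) ^ g + r * c * (y l - y j) ^ g := by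
        refine add_le_add (e2.trans ?_) (e1.trans ?_)
        · gcongr
        · gcongr
      _ = _ := by ring

lemma box_sum (hE : ∀ i j, θ (i+1) (j+1) = θ (i+1) j + θ i (j+1) - θ i j
    + Φ i (i+1) j (j+1) (θ i j)) {i k j l : ℕ} (hik : i ≤ k) (hjl : j ≤ l) :
    θ k l - θ k j - θ i l + θ i j =
      ∑ a ∈ Finset.Ico i k, ∑ b ∈ Finset.Ico j l, Φ a (a+1) b (b+1) (θ a b) := by
  have e : ∀ a ∈ Finset.Ico i k, ∑ b ∈ Finset.Ico j l, Φ a (a+1) b (b+1) (θ a b)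
      = (θ (a+1) l - θ (a+1) j) - (θ a l - θ a j) := by
    intro a _
    have : ∀ b ∈ Finset.Ico j l, Φ a (a+1) b (b+1) (θ a b)
        = (θ (a+1) (b+1) - θ a (b+1)) - (θ (a+1) b - θ a b) := by
      intro b _; rw [hE]; abel
    rw [Finset.sum_congr rfl this, Finset.sum_Ico_sub (fun b => θ (a+1) b - θ a b) hjl]
    abel
  rw [Finset.sum_congr rfl e, Finset.sum_Ico_sub (fun a => θ a l - θ a j) hik]
  abel

lemma apriori (hΦ : GermFam η g1 g2 M x y Φ) (hx : Monotone x) (hy : Monotone y)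
    (hM : 0 ≤ M) (hg1 : 1/2 < g1) (hg2 : 1/2 < g2)
    (hE : ∀ i j, θ (i+1) (j+1) = θ (i+1) j + θ i (j+1) - θ i j
      + Φ i (i+1) j (j+1) (θ i j)) {N m : ℕ} {h L K1 K2 : ℝ} (hh : 0 ≤ h) (hL : 0 ≤ L)
    (hxm : ∀ i k, i ≤ k → k ≤ i + m → x k - x i ≤ h)
    (hym : ∀ i k, i ≤ k → k ≤ i + m → y k - y i ≤ h)
    (hb1 : ∀ i k, i ≤ k → ‖θ k 0 - θ i 0‖ ≤ L * (x k - x i) ^ g1)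
    (hb2 : ∀ i k, i ≤ k → ‖θ 0 k - θ 0 i‖ ≤ L * (y k - y i) ^ g2)
    (hK1 : K1 = L + N * (2 * M * h ^ g2)) (hK2 : K2 = L + N * (2 * M * h ^ g1))
    (hsmall : kap (2 * g1) * K1 * h ^ g1
      + kap (2 * g1) * kap (2 * g2) * (2 * M + K1 * K2) * h ^ g1 * h ^ g2
      + kap (2 * g2) * K2 * h ^ g2 ≤ 1) :
    ∀ k l i j, k ≤ N * m → l ≤ N * m → i ≤ k → j ≤ l → k ≤ i + m → l ≤ j + m →
      ‖θ k l - θ k j - θ i l + θ i j‖ ≤ 2 * M * (x k - x i) ^ g1 * (y l - y j) ^ g2 := by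
  have p1 : 1 < 2 * g1 := by linarith
  have p2 : 1 < 2 * g2 := by linarith
  have κ1 := kap_pos p1
  have κ2 := kap_pos p2
  have hg1' : 0 ≤ g1 := by linarith
  have hg2' : 0 ≤ g2 := by linarith
  have hh1 : 0 ≤ h ^ g1 := Real.rpow_nonneg hh _
  have hh2 : 0 ≤ h ^ g2 := Real.rpow_nonneg hh _
  have hK1n : 0 ≤ K1 := by rw [hK1]; positivity
  have hK2n : 0 ≤ K2 := by rw [hK2]; positivity
  intro k
  induction k using Nat.strong_induction_on with
  | _ k ih =>
  intro l i j hk hl hik hjl hkm hlm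
  have X0 := rpow_nn hx (g := g1) hik
  have Y0 := rpow_nn hy (g := g2) hjl
  rcases Nat.eq_or_lt_of_le hik with h1 | h1
  · subst h1
    have : θ i l - θ i j - θ i l + θ i j = 0 := by abel
    rw [this, norm_zero]; positivity
  rcases Nat.eq_or_lt_of_le hjl with h2 | h2
  · subst h2
    have : θ k j - θ k j - θ i j + θ i j = 0 := by abel
    rw [this, norm_zero]; positivity
  -- increments
  have I1 : ∀ u u' v, u ≤ u' → u' < k → u' ≤ u + m → v < l →
      ‖θ u' v - θ u v‖ ≤ K1 * (x u' - x u) ^ g1 := by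
    intro u u' v a1 a2 a3 a4
    have n1 := rpow_nn hx (g := g1) a1
    have c := chop hy (f := fun w => θ u' w - θ u w) (m := m) (v := v)
      (c := 2 * M * (x u' - x u) ^ g1 * h ^ g2) (g := 0) (by positivity) le_rfl
      (fun j' l' b1 b2 b3 => by
        have := ih u' a2 l' u j' (by omega) (by omega) a1 b1 a3 b3
        have e : θ u' l' - θ u l' - (θ u' j' - θ u j') = θ u' l' - θ u' j' - θ u l' + θ u j' := by
          abel
        have q : (y l' - y j') ^ g2 ≤ h ^ g2 :=
          Real.rpow_le_rpow (sub_nonneg.2 (hy b1)) (hym _ _ b1 b3) hg2'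
        rw [e, Real.rpow_zero, mul_one]
        exact this.trans (by gcongr)) N 0 v (Nat.zero_le _) le_rfl (by omega)
    have b := hb1 u u' a1
    have e : θ u' v - θ u v = (θ u' v - θ u v - (θ u' 0 - θ u 0)) + (θ u' 0 - θ u 0) := by abel
    rw [e, hK1]
    refine (norm_add_le _ _).trans ((add_le_add c b).trans (le_of_eq ?_))
    rw [Real.rpow_zero]; ring
  have I2 : ∀ v v' u, v ≤ v' → v' < l → v' ≤ v + m → u < k →
      ‖θ u v' - θ u v‖ ≤ K2 * (y v' - y v) ^ g2 := by
    intro v v' u a1 a2 a3 a4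
    have n1 := rpow_nn hy (g := g2) a1
    have c := chop hx (f := fun w => θ w v' - θ w v) (m := m) (v := u)
      (c := 2 * M * h ^ g1 * (y v' - y v) ^ g2) (g := 0) (by positivity) le_rfl
      (fun j' l' b1 b2 b3 => by
        have := ih l' (by omega) v' j' v (by omega) (by omega) b1 a1 b3 a3
        have e : θ l' v' - θ l' v - (θ j' v' - θ j' v) = θ l' v' - θ l' v - θ j' v' + θ j' v := by
          abel
        have q : (x l' - x j') ^ g1 ≤ h ^ g1 :=
          Real.rpow_le_rpow (sub_nonneg.2 (hx b1)) (hxm _ _ b1 b3) hg1'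
        rw [e, Real.rpow_zero, mul_one]
        exact this.trans (by gcongr)) N 0 u (Nat.zero_le _) le_rfl (by omega)
    have b := hb2 v v' a1
    have e : θ u v' - θ u v = (θ u v' - θ u v - (θ 0 v' - θ 0 v)) + (θ 0 v' - θ 0 v) := by abel
    rw [e, hK2]
    refine (norm_add_le _ _).trans ((add_le_add c b).trans (le_of_eq ?_))
    rw [Real.rpow_zero]; ring
  have S := sew2 hx hy (G := fun i k j l => Φ i k j l (θ i j)) p1 p2
    (C1 := M * K1 * (y l - y j) ^ g2) (C2 := M * K2 * (x k - x i) ^ g1)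
    (C12 := M * (2 * M + K1 * K2)) (by positivity) (by positivity) (by positivity) h1 h2
    (fun i' u k' b1 b2 b3 b4 => hΦ.d1_le hx hy hM hg1' b2.le b3.le hjl hK1n
      (I1 i' u j b2.le (by omega) (by omega) h2))
    (fun j' v l' b1 b2 b3 b4 => hΦ.d2_le hx hy hM hg2' b2.le b3.le hik hK2n
      (I2 j' v i b2.le (by omega) (by omega) h1))
    (fun i' u k' j' v l' b1 b2 b3 b4 b5 b6 b7 b8 => hΦ.d12_le hx hy hM hg1' hg2' b2.le b3.le b6.le
      b7.le hK1n hK2n (by positivity) (I1 i' u v b2.le (by omega) (by omega) (by omega))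
      (I2 j' v u b6.le (by omega) (by omega) (by omega))
      (ih u (by omega) v i' j' (by omega) (by omega) b2.le b6.le (by omega) (by omega)))
  rw [← box_sum hE hik hjl] at S
  obtain ⟨F', F'', hF⟩ := hΦ.reg i k j l hik hjl
  have B0 := hF.b0 (θ i j)
  have Xh : (x k - x i) ^ g1 ≤ h ^ g1 :=
    Real.rpow_le_rpow (sub_nonneg.2 (hx hik)) (hxm _ _ hik hkm) hg1'
  have Yh : (y l - y j) ^ g2 ≤ h ^ g2 :=
    Real.rpow_le_rpow (sub_nonneg.2 (hy hjl)) (hym _ _ hjl hlm) hg2'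
  rw [rpow_two_mul (sub_nonneg.2 (hx hik)) hg1', rpow_two_mul (sub_nonneg.2 (hy hjl)) hg2'] at S
  set X := (x k - x i) ^ g1
  set Y := (y l - y j) ^ g2
  have small2 : kap (2 * g1) * K1 * X
      + kap (2 * g1) * kap (2 * g2) * (2 * M + K1 * K2) * X * Y
      + kap (2 * g2) * K2 * Y ≤ 1 := by
    refine le_trans ?_ hsmall
    gcongr
  have t := norm_le_norm_add_norm_sub (Φ i k j l (θ i j)) (θ k l - θ k j - θ i l + θ i j)
  rw [norm_sub_rev] at t
  calc _ ≤ _ := t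
    _ ≤ M * (X * Y) + _ := add_le_add B0 S
    _ = M * X * Y + M * X * Y * (kap (2 * g1) * K1 * X
      + kap (2 * g1) * kap (2 * g2) * (2 * M + K1 * K2) * X * Y
      + kap (2 * g2) * K2 * Y) := by ring
    _ ≤ M * X * Y + M * X * Y * 1 := by gcongr
    _ = _ := by ring

lemma global_box (hx : Monotone x) (hy : Monotone y) (hM : 0 ≤ M) (hg1 : 0 ≤ g1) (hg2 : 0 ≤ g2)
    {N m : ℕ}
    (H : ∀ k l i j, k ≤ N * m → l ≤ N * m → i ≤ k → j ≤ l → k ≤ i + m → l ≤ j + m →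
      ‖θ k l - θ k j - θ i l + θ i j‖ ≤ 2 * M * (x k - x i) ^ g1 * (y l - y j) ^ g2) :
    ∀ k l i j, k ≤ N * m → l ≤ N * m → i ≤ k → j ≤ l →
      ‖θ k l - θ k j - θ i l + θ i j‖ ≤ N * N * (2 * M) * (x k - x i) ^ g1 * (y l - y j) ^ g2 := by
  intro k l i j hk hl hik hjl
  have n2 := rpow_nn hy (g := g2) hjl
  have c := chop hx (f := fun w => θ w l - θ w j) (m := m) (v := k)
      (c := N * (2 * M) * (y l - y j) ^ g2) (g := g1) (by positivity) hg1
      (fun i' k' b1 b2 b3 => by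
        have n1 := rpow_nn hx (g := g1) b1
        have c' := chop hy (f := fun w => θ k' w - θ i' w) (m := m) (v := l)
          (c := 2 * M * (x k' - x i') ^ g1) (g := g2) (by positivity) hg2
          (fun j' l' d1 d2 d3 => by
            have := H k' l' i' j' (by omega) (by omega) b1 d1 b3 d3
            have e : θ k' l' - θ i' l' - (θ k' j' - θ i' j')
              = θ k' l' - θ k' j' - θ i' l' + θ i' j' := by abel
            rw [e]; exact this) N j l hjl le_rfl (by omega)
        have e : θ k' l - θ k' j - (θ i' l - θ i' j) = θ k' l - θ i' l - (θ k' j - θ i' j) := by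
          abel
        rw [e]
        exact c'.trans (le_of_eq (by ring))) N i k hik le_rfl (by omega)
  have e : θ k l - θ k j - θ i l + θ i j = θ k l - θ k j - (θ i l - θ i j) := by abel
  rw [e]
  exact c.trans (le_of_eq (by ring))

end germ



lemma memHolder_iff {V : Type*} [NormedAddCommGroup V] {T : ℝ} {γ : ℝ × ℝ} (h1 : 0 < γ.1)
    (h2 : 0 < γ.2) (f : ℝ × ℝ → V) : MemHolder (Sq T) γ f ↔ ∃ K, 0 ≤ K ∧
      (∀ s ∈ Sq T, ∀ t ∈ Sq T, ‖f (t.1, s.2) - f (s.1, s.2)‖ ≤ K * |t.1 - s.1| ^ γ.1) ∧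
      (∀ s ∈ Sq T, ∀ t ∈ Sq T, ‖f (s.1, t.2) - f (s.1, s.2)‖ ≤ K * |t.2 - s.2| ^ γ.2) ∧
      (∀ s ∈ Sq T, ∀ t ∈ Sq T,
        ‖box f s t‖ ≤ K * |t.1 - s.1| ^ γ.1 * |t.2 - s.2| ^ γ.2) := by
  constructor
  · rintro ⟨⟨K1, H1⟩, ⟨K2, H2⟩, ⟨K3, H3⟩⟩
    refine ⟨max (max K1 K2) (max K3 0), le_max_of_le_right (le_max_right _ _), ?_, ?_, ?_⟩
    · intro s hs t ht
      by_cases h : t.1 - s.1 = 0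
      · have : t.1 = s.1 := by linarith
        rw [this]; simp [Real.zero_rpow h1.ne']
      · have := H1 ⟨s, hs, t, ht, rfl⟩
        have hp : 0 < |t.1 - s.1| ^ γ.1 := Real.rpow_pos_of_pos (abs_pos.2 h) _
        rw [div_le_iff₀ hp] at this
        exact this.trans (by gcongr; exact (le_max_left _ _).trans (le_max_left _ _))
    · intro s hs t ht
      by_cases h : t.2 - s.2 = 0
      · have : t.2 = s.2 := by linarith
        rw [this]; simp [Real.zero_rpow h2.ne']
      · have := H2 ⟨s, hs, t, ht, rfl⟩
        have hp : 0 < |t.2 - s.2| ^ γ.2 := Real.rpow_pos_of_pos (abs_pos.2 h) _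
        rw [div_le_iff₀ hp] at this
        exact this.trans (by gcongr; exact (le_max_right _ _).trans (le_max_left _ _))
    · intro s hs t ht
      by_cases h : t.1 - s.1 = 0
      · have : t.1 = s.1 := by linarith
        simp [box, this, Real.zero_rpow h1.ne']
      by_cases h' : t.2 - s.2 = 0
      · have : t.2 = s.2 := by linarith
        simp [box, this, Real.zero_rpow h2.ne']
      have := H3 ⟨s, hs, t, ht, rfl⟩
      have hp : 0 < |t.1 - s.1| ^ γ.1 := Real.rpow_pos_of_pos (abs_pos.2 h) _
      have hp' : 0 < |t.2 - s.2| ^ γ.2 := Real.rpow_pos_of_pos (abs_pos.2 h') _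
      rw [mPow, div_le_iff₀ (by positivity)] at this
      rw [mul_assoc]
      exact this.trans (by gcongr; exact (le_max_left _ _).trans (le_max_right _ _))
  · rintro ⟨K, hK, H1, H2, H3⟩
    refine ⟨⟨K, ?_⟩, ⟨K, ?_⟩, ⟨K, ?_⟩⟩
    · rintro _ ⟨s, hs, t, ht, rfl⟩
      exact div_le_of_le_mul₀ (by positivity) hK (H1 s hs t ht)
    · rintro _ ⟨s, hs, t, ht, rfl⟩
      exact div_le_of_le_mul₀ (by positivity) hK (H2 s hs t ht)
    · rintro _ ⟨s, hs, t, ht, rfl⟩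
      refine div_le_of_le_mul₀ (by unfold mPow; positivity) hK ?_
      rw [mPow, ← mul_assoc]
      exact H3 s hs t ht

/-- Choice of the coarse number of steps. -/
lemma choose_N {T g1 g2 M L k1 k2 : ℝ} (hT : 0 < T) (hg1 : 1/2 < g1) (hg2 : 1/2 < g2) :
    ∃ N : ℕ, 0 < N ∧ k1 * (L + N * (2 * M * (T / N) ^ g2)) * (T / N) ^ g1
      + k1 * k2 * (2 * M + (L + N * (2 * M * (T / N) ^ g2)) * (L + N * (2 * M * (T / N) ^ g1)))
        * (T / N) ^ g1 * (T / N) ^ g2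
      + k2 * (L + N * (2 * M * (T / N) ^ g1)) * (T / N) ^ g2 ≤ 1 := by
  have h0 : Tendsto (fun N : ℕ => T / (N:ℝ)) atTop (𝓝 0) := tendsto_const_div_atTop_nhds_zero_nat T
  have pw : ∀ g : ℝ, 0 < g → Tendsto (fun N : ℕ => (T / (N:ℝ)) ^ g) atTop (𝓝 0) := by
    intro g hg
    have := h0.rpow_const (p := g) (Or.inr hg.le)
    rwa [Real.zero_rpow hg.ne'] at this
  have hu := pw g1 (by linarith)
  have hv := pw g2 (by linarith)
  have hw : Tendsto (fun N : ℕ => (N:ℝ) * (T / (N:ℝ)) ^ g1 * (T / (N:ℝ)) ^ g2) atTop (𝓝 0) := by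
    have := (pw (g1 + g2 - 1) (by linarith)).const_mul T
    rw [mul_zero] at this
    refine this.congr' ?_
    filter_upwards [eventually_gt_atTop 0] with N hN
    have hN' : (0:ℝ) < N := by exact_mod_cast hN
    have hTN : 0 < T / N := by positivity
    rw [mul_assoc, ← Real.rpow_add hTN, Real.rpow_sub hTN, Real.rpow_one]
    field_simp
  have hall : Tendsto (fun N : ℕ => k1 * (L * (T / (N:ℝ)) ^ g1
        + 2 * M * ((N:ℝ) * (T / (N:ℝ)) ^ g1 * (T / (N:ℝ)) ^ g2))
      + k1 * k2 * (2 * M * ((T / (N:ℝ)) ^ g1 * (T / (N:ℝ)) ^ g2) + (L * (T / (N:ℝ)) ^ g1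
        + 2 * M * ((N:ℝ) * (T / (N:ℝ)) ^ g1 * (T / (N:ℝ)) ^ g2)) * (L * (T / (N:ℝ)) ^ g2
        + 2 * M * ((N:ℝ) * (T / (N:ℝ)) ^ g1 * (T / (N:ℝ)) ^ g2)))
      + k2 * (L * (T / (N:ℝ)) ^ g2
        + 2 * M * ((N:ℝ) * (T / (N:ℝ)) ^ g1 * (T / (N:ℝ)) ^ g2))) atTop
      (𝓝 (k1 * (L * 0 + 2 * M * 0) + k1 * k2 * (2 * M * (0 * 0) + (L * 0 + 2 * M * 0)
        * (L * 0 + 2 * M * 0)) + k2 * (L * 0 + 2 * M * 0))) := by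
    have a := (hu.const_mul L).add (hw.const_mul (2 * M))
    have b := (hv.const_mul L).add (hw.const_mul (2 * M))
    exact ((a.const_mul k1).add ((((hu.mul hv).const_mul (2 * M)).add (a.mul b)).const_mul
      (k1 * k2))).add (b.const_mul k2)
  have e : (k1 * (L * 0 + 2 * M * 0) + k1 * k2 * (2 * M * (0 * 0) + (L * 0 + 2 * M * 0)
        * (L * 0 + 2 * M * 0)) + k2 * (L * 0 + 2 * M * 0)) = (0:ℝ) := by ring
  rw [e] at hall
  obtain ⟨N, hN, hN0⟩ := ((hall.eventually_le_const (show (0:ℝ) < 1 by norm_num)).and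
    (eventually_gt_atTop 0)).exists
  exact ⟨N, hN0, le_trans (le_of_eq (by ring)) hN⟩

/-- The clamped uniform grid. -/
def grid (T : ℝ) (n : ℕ) (i : ℕ) : ℝ := min (i * (T / n)) T

lemma grid_mono {T : ℝ} (hT : 0 < T) (n : ℕ) : Monotone (grid T n) := by
  intro i k h
  have : (i:ℝ) ≤ k := by exact_mod_cast h
  have h2 : 0 ≤ T / n := by positivity
  unfold grid
  gcongr

lemma grid_zero {T : ℝ} (hT : 0 < T) (n : ℕ) : grid T n 0 = 0 := by
  simp [grid, hT.le]

lemma grid_mem {T : ℝ} (hT : 0 < T) (n i : ℕ) : grid T n i ∈ Icc 0 T := by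
  refine ⟨?_, min_le_right _ _⟩
  rw [← grid_zero hT n]; exact grid_mono hT n (Nat.zero_le i)

lemma grid_step {T : ℝ} (hT : 0 < T) {N m : ℕ} (hN : 0 < N) (hm : 0 < m) (i k : ℕ) (_ : i ≤ k)
    (h : k ≤ i + m) : grid T (N * m) k - grid T (N * m) i ≤ T / N := by
  have h' : (k:ℝ) ≤ i + m := by exact_mod_cast h
  have hN' : (0:ℝ) < N := by exact_mod_cast hN
  have hm' : (0:ℝ) < m := by exact_mod_cast hm
  have e : (m:ℝ) * (T / ((N * m : ℕ) : ℝ)) = T / N := by push_cast; field_simp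
  have p : 0 ≤ T / ((N * m : ℕ) : ℝ) := by positivity
  have p' : 0 ≤ T / N := by positivity
  have : (k:ℝ) * (T / ((N * m : ℕ) : ℝ)) ≤ i * (T / ((N * m : ℕ) : ℝ)) + T / N := by
    rw [← e]; nlinarith
  unfold grid
  rcases le_total ((i:ℝ) * (T / ((N * m : ℕ) : ℝ))) T with q | q
  · rw [min_eq_left q]
    linarith [min_le_left ((k:ℝ) * (T / ((N * m : ℕ) : ℝ))) T]
  · rw [min_eq_right q]
    linarith [min_le_right ((k:ℝ) * (T / ((N * m : ℕ) : ℝ))) T]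

lemma grid_floor {T : ℝ} (hT : 0 < T) {n : ℕ} (hn : 0 < n) {s : ℝ} (hs : s ∈ Icc 0 T) :
    ⌊s * n / T⌋₊ ≤ n ∧ |grid T n ⌊s * n / T⌋₊ - s| ≤ T / n := by
  have hn' : (0:ℝ) < n := by exact_mod_cast hn
  have h0 : 0 ≤ s * n / T := by have := hs.1; positivity
  have h1 : s * n / T ≤ n := by
    rw [div_le_iff₀ hT]; nlinarith [hs.2]
  refine ⟨Nat.floor_le_of_le h1, ?_⟩
  have f1 := Nat.floor_le h0
  have f2 := Nat.lt_floor_add_one (s * n / T)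
  set a := ⌊s * n / T⌋₊
  have e : s = (s * n / T) * (T / n) := by field_simp
  have p : 0 < T / n := by positivity
  have b1 : (a:ℝ) * (T / n) ≤ s := by
    calc (a:ℝ) * (T / n) ≤ (s * n / T) * (T / n) := by gcongr
      _ = s := e.symm
  have b2 : s ≤ (a:ℝ) * (T / n) + T / n := by
    calc s = (s * n / T) * (T / n) := e
      _ ≤ ((a:ℝ) + 1) * (T / n) := by gcongr
      _ = _ := by ring
  have : grid T n a = a * (T / n) := min_eq_left (b1.trans hs.2)
  rw [this, abs_le]
  constructor <;> linarith

/-- The Euler scheme. -/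
def euler {V : Type*} [NormedAddCommGroup V] (Φ : ℕ → ℕ → ℕ → ℕ → V → V) (b1 b2 : ℕ → V) :
    ℕ → ℕ → V
  | 0, j => b2 j
  | i + 1, 0 => b1 (i + 1)
  | i + 1, j + 1 => euler Φ b1 b2 (i + 1) j + euler Φ b1 b2 i (j + 1) - euler Φ b1 b2 i j
      + Φ i (i + 1) j (j + 1) (euler Φ b1 b2 i j)
  termination_by i j => i + j

/-- Properties of the Euler scheme on a grid. -/
structure EulerSol {V : Type*} [NormedAddCommGroup V] (A : ℝ × ℝ → V → V) (ξ : ℝ × ℝ → V)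
    (g1 g2 K : ℝ) (x : ℕ → ℝ) (n : ℕ) (θ : ℕ → ℕ → V) : Prop where
  b1 : ∀ i, θ i 0 = ξ (x i, 0)
  b2 : ∀ j, θ 0 j = ξ (0, x j)
  eq : ∀ i j, θ (i+1) (j+1) = θ (i+1) j + θ i (j+1) - θ i j
      + box (fun r => A r (θ i j)) (x i, x j) (x (i+1), x (j+1))
  k1 : ∀ i k v, i ≤ k → k ≤ n → v ≤ n → ‖θ k v - θ i v‖ ≤ K * (x k - x i) ^ g1
  k2 : ∀ j l u, j ≤ l → l ≤ n → u ≤ n → ‖θ u l - θ u j‖ ≤ K * (x l - x j) ^ g2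
  k12 : ∀ i k j l, i ≤ k → k ≤ n → j ≤ l → l ≤ n →
    ‖θ k l - θ k j - θ i l + θ i j‖ ≤ K * (x k - x i) ^ g1 * (x l - x j) ^ g2

lemma euler_exists {V : Type*} [NormedAddCommGroup V] [NormedSpace ℝ V] {T : ℝ} (hT : 0 < T)
    {γ : ℝ × ℝ} {η M L : ℝ} (hg1 : 1/2 < γ.1) (hg2 : 1/2 < γ.2)
    {A : ℝ × ℝ → V → V} {DA : ℝ × ℝ → V → V →L[ℝ] V} {D2A : ℝ × ℝ → V → V →L[ℝ] V →L[ℝ] V}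
    (hM : 0 ≤ M) (hA : MemCtC2 T γ η A DA D2A M) {ξ : ℝ × ℝ → V} (hL : 0 ≤ L)
    (x1 : ∀ s ∈ Sq T, ∀ t ∈ Sq T, ‖ξ (t.1, s.2) - ξ (s.1, s.2)‖ ≤ L * |t.1 - s.1| ^ γ.1)
    (x2 : ∀ s ∈ Sq T, ∀ t ∈ Sq T, ‖ξ (s.1, t.2) - ξ (s.1, s.2)‖ ≤ L * |t.2 - s.2| ^ γ.2) :
    ∃ (N : ℕ) (K : ℝ), 0 < N ∧ 0 ≤ K ∧ ∀ m, 0 < m →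
      ∃ θ, EulerSol A ξ γ.1 γ.2 K (grid T (N * m)) (N * m) θ := by
  obtain ⟨N, hN, hsmall⟩ := choose_N (M := M) (L := L) (k1 := kap (2 * γ.1)) (k2 := kap (2 * γ.2))
    hT hg1 hg2
  have T1 : 0 ≤ T ^ γ.1 := Real.rpow_nonneg hT.le _
  have T2 : 0 ≤ T ^ γ.2 := Real.rpow_nonneg hT.le _
  set K := L + N * N * (2 * M) * (1 + T ^ γ.1 + T ^ γ.2) with hK
  have hK0 : 0 ≤ K := by positivity
  refine ⟨N, K, hN, hK0, fun m hm => ?_⟩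
  set x := grid T (N * m) with hxdef
  have hx : Monotone x := grid_mono hT _
  have hxT : ∀ i, x i ∈ Icc 0 T := grid_mem hT _
  have hx0 : x 0 = 0 := grid_zero hT _
  have hΦ := germFam_of hA hx hx hxT hxT
  set Φ : ℕ → ℕ → ℕ → ℕ → V → V := fun i k j l z => box (fun r => A r z) (x i, x j) (x k, x l)
  set θ := euler Φ (fun i => ξ (x i, 0)) (fun j => ξ (0, x j)) with hθ
  have mem0 : ∀ i, (x i, (0:ℝ)) ∈ Sq T := fun i => ⟨⟨(hxT i).1, le_rfl⟩, ⟨(hxT i).2, hT.le⟩⟩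
  have mem0' : ∀ i, ((0:ℝ), x i) ∈ Sq T := fun i => ⟨⟨le_rfl, (hxT i).1⟩, ⟨hT.le, (hxT i).2⟩⟩
  have e1 : ∀ i, θ i 0 = ξ (x i, 0) := by
    intro i
    cases i with
    | zero => rw [hθ, euler, hx0]
    | succ i => rw [hθ, euler]
  have e2 : ∀ j, θ 0 j = ξ (0, x j) := fun j => by rw [hθ, euler]
  have hE : ∀ i j, θ (i+1) (j+1) = θ (i+1) j + θ i (j+1) - θ i j
      + Φ i (i+1) j (j+1) (θ i j) := fun i j => by rw [hθ, euler]
  have hb1 : ∀ i k, i ≤ k → ‖θ k 0 - θ i 0‖ ≤ L * (x k - x i) ^ γ.1 := by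
    intro i k h
    have := x1 _ (mem0 i) _ (mem0 k)
    rw [e1, e1]
    rwa [abs_of_nonneg (sub_nonneg.2 (hx h))] at this
  have hb2 : ∀ i k, i ≤ k → ‖θ 0 k - θ 0 i‖ ≤ L * (x k - x i) ^ γ.2 := by
    intro i k h
    have := x2 _ (mem0' i) _ (mem0' k)
    rw [e2, e2]
    rwa [abs_of_nonneg (sub_nonneg.2 (hx h))] at this
  have loc := apriori hΦ hx hx hM hg1 hg2 hE (N := N) (m := m) (h := T / N) (by positivity) hL
    (grid_step hT hN hm) (grid_step hT hN hm) hb1 hb2 rfl rfl hsmall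
  have gb := global_box hx hx hM (by linarith) (by linarith) loc
  refine ⟨θ, e1, e2, hE, ?_, ?_, ?_⟩
  · intro i k v h1 h2 h3
    have b := hb1 i k h1
    have g := gb k v i 0 h2 h3 h1 (Nat.zero_le _)
    have X0 := rpow_nn hx (g := γ.1) h1
    have Y : (x v - x 0) ^ γ.2 ≤ T ^ γ.2 :=
      Real.rpow_le_rpow (sub_nonneg.2 (hx (Nat.zero_le _))) (by rw [hx0]; linarith [(hxT v).2])
        (by linarith)
    have e : θ k v - θ i v = (θ k v - θ k 0 - θ i v + θ i 0) + (θ k 0 - θ i 0) := by abel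
    rw [e]
    calc _ ≤ _ := norm_add_le _ _
      _ ≤ N * N * (2 * M) * (x k - x i) ^ γ.1 * T ^ γ.2 + L * (x k - x i) ^ γ.1 := by
        refine add_le_add (g.trans ?_) b
        gcongr
      _ = (L + N * N * (2 * M) * (0 + 0 + T ^ γ.2)) * (x k - x i) ^ γ.1 := by ring
      _ ≤ _ := by rw [hK]; gcongr; norm_num
  · intro j l u h1 h2 h3
    have b := hb2 j l h1
    have g := gb u l 0 j h3 h2 (Nat.zero_le _) h1
    have X0 := rpow_nn hx (g := γ.2) h1
    have Y : (x u - x 0) ^ γ.1 ≤ T ^ γ.1 :=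
      Real.rpow_le_rpow (sub_nonneg.2 (hx (Nat.zero_le _))) (by rw [hx0]; linarith [(hxT u).2])
        (by linarith)
    have e : θ u l - θ u j = (θ u l - θ u j - θ 0 l + θ 0 j) + (θ 0 l - θ 0 j) := by abel
    rw [e]
    calc _ ≤ _ := norm_add_le _ _
      _ ≤ N * N * (2 * M) * T ^ γ.1 * (x l - x j) ^ γ.2 + L * (x l - x j) ^ γ.2 := by
        refine add_le_add (g.trans ?_) b
        gcongr
      _ = (L + N * N * (2 * M) * (0 + T ^ γ.1 + 0)) * (x l - x j) ^ γ.2 := by ring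
      _ ≤ _ := by rw [hK]; gcongr; norm_num
  · intro i k j l h1 h2 h3 h4
    have X0 := rpow_nn hx (g := γ.1) h1
    have Y0 := rpow_nn hx (g := γ.2) h3
    refine (gb k l i j h2 h4 h1 h3).trans ?_
    gcongr
    calc (N:ℝ) * N * (2 * M) = 0 + N * N * (2 * M) * (1 + 0 + 0) := by ring
      _ ≤ _ := by rw [hK]; gcongr

lemma EulerSol.coarse {V : Type*} [NormedAddCommGroup V] [NormedSpace ℝ V] {T : ℝ} (hT : 0 < T)
    {γ : ℝ × ℝ} {η M K : ℝ} (hg1 : 1/2 < γ.1) (hg2 : 1/2 < γ.2)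
    {A : ℝ × ℝ → V → V} {DA : ℝ × ℝ → V → V →L[ℝ] V} {D2A : ℝ × ℝ → V → V →L[ℝ] V →L[ℝ] V}
    (hM : 0 ≤ M) (hA : MemCtC2 T γ η A DA D2A M) {ξ : ℝ × ℝ → V} (hK : 0 ≤ K) {n : ℕ}
    {θ : ℕ → ℕ → V} (h : EulerSol A ξ γ.1 γ.2 K (grid T n) n θ) {α β : ℕ → ℕ} (hα : Monotone α)
    (hα0 : α 0 = 0) (hβ : Monotone β) (hβ0 : β 0 = 0) {q r : ℕ} (hq : α q ≤ n) (hr : β r ≤ n) :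
    ‖(θ (α q) (β r) - θ (α q) 0 - θ 0 (β r) + θ 0 0)
      - ∑ i ∈ Finset.range q, ∑ j ∈ Finset.range r,
        box (fun r => A r (θ (α i) (β j))) (grid T n (α i), grid T n (β j))
          (grid T n (α (i+1)), grid T n (β (j+1)))‖ ≤
      kap (2 * γ.1) * (M * K * T ^ γ.2 + kap (2 * γ.2) * (M * (K + K * K)) * T ^ (2 * γ.2))
          * ∑ i ∈ Finset.range q, (grid T n (α (i+1)) - grid T n (α i)) ^ (2 * γ.1)
        + kap (2 * γ.2) * (M * K * T ^ γ.1 + kap (2 * γ.1) * (M * (K + K * K)) * T ^ (2 * γ.1))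
          * ∑ j ∈ Finset.range r, (grid T n (β (j+1)) - grid T n (β j)) ^ (2 * γ.2) := by
  set x := grid T n with hxdef
  have hx : Monotone x := grid_mono hT _
  have hxT : ∀ i, x i ∈ Icc 0 T := grid_mem hT _
  have hx0 : x 0 = 0 := grid_zero hT _
  have hΦ := germFam_of hA hx hx hxT hxT
  have g1 : 0 ≤ γ.1 := by linarith
  have g2 : 0 ≤ γ.2 := by linarith
  have p1 : 1 < 2 * γ.1 := by linarith
  have p2 : 1 < 2 * γ.2 := by linarith
  have T1 : 0 ≤ T ^ γ.1 := Real.rpow_nonneg hT.le _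
  have T2 : 0 ≤ T ^ γ.2 := Real.rpow_nonneg hT.le _
  have κ1 := kap_pos p1
  have κ2 := kap_pos p2
  have bT : ∀ (g : ℝ) (u v : ℕ), 0 ≤ g → u ≤ v → (x v - x u) ^ g ≤ T ^ g := by
    intro g u v hg huv
    exact Real.rpow_le_rpow (sub_nonneg.2 (hx huv)) (by linarith [(hxT v).2, (hxT u).1]) hg
  have S := coarse2 hx hx (G := fun i k j l => box (fun r => A r (θ i j)) (x i, x j) (x k, x l))
    p1 p2 (C1 := M * K * T ^ γ.2) (C2 := M * K * T ^ γ.1) (C12 := M * (K + K * K))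
    (by positivity) (by positivity) (by positivity) hα hα0 hβ hβ0 q r
    (fun i j l => hΦ.zero1 i j l _) (fun i k j => hΦ.zero2 i k j _)
    (fun i u k b1 b2 b3 => by
      have X0 := rpow_nn hx (g := 2 * γ.1) (b1.trans b2)
      refine (hΦ.d1_le hx hx hM g1 b1 b2 (Nat.zero_le _) hK
        (h.k1 i u 0 b1 (by omega) (by omega))).trans ?_
      have := bT γ.2 0 (β r) g2 (Nat.zero_le _)
      gcongr)
    (fun i u k b1 b2 b3 => by
      have X0 := rpow_nn hx (g := 2 * γ.2) (b1.trans b2)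
      refine (hΦ.d2_le hx hx hM g2 b1 b2 (Nat.zero_le _) hK
        (h.k2 i u 0 b1 (by omega) (by omega))).trans ?_
      have := bT γ.1 0 (α q) g1 (Nat.zero_le _)
      gcongr)
    (fun i u k j v l b1 b2 b3 b4 b5 b6 => hΦ.d12_le hx hx hM g1 g2 b1 b2 b4 b5 hK hK hK
      (h.k1 i u v b1 (by omega) (by omega)) (h.k2 j v u b4 (by omega) (by omega))
      (h.k12 i u j v b1 (by omega) b4 (by omega)))
  have bs := box_sum (Φ := fun i k j l z => box (fun r => A r z) (x i, x j) (x k, x l)) h.eq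
    (Nat.zero_le (α q)) (Nat.zero_le (β r))
  simp only [← Finset.range_eq_Ico] at bs
  rw [bs]
  refine S.trans ?_
  have t1 := bT (2 * γ.1) 0 (α q) (by linarith) (Nat.zero_le _)
  have t2 := bT (2 * γ.2) 0 (β r) (by linarith) (Nat.zero_le _)
  have s1 : 0 ≤ ∑ i ∈ Finset.range q, (x (α (i+1)) - x (α i)) ^ (2 * γ.1) :=
    Finset.sum_nonneg fun i _ => rpow_nn hx (hα (Nat.le_succ i))
  have s2 : 0 ≤ ∑ i ∈ Finset.range r, (x (β (i+1)) - x (β i)) ^ (2 * γ.2) :=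
    Finset.sum_nonneg fun i _ => rpow_nn hx (hβ (Nat.le_succ i))
  gcongr



/-- The points of a partition as a sequence indexed by naturals. -/
def Partition.seq {a b : ℝ} (P : Partition a b) (i : ℕ) : ℝ := P.pts ⟨min i (P.n + 1), by omega⟩

lemma Partition.seq_mono {a b : ℝ} (P : Partition a b) : Monotone P.seq := by
  intro i k h
  apply P.mono
  rw [Fin.mk_le_mk]
  omega

lemma Partition.seq_zero {a b : ℝ} (P : Partition a b) : P.seq 0 = a := by
  refine Eq.trans ?_ P.first; unfold Partition.seq; congr 1

lemma Partition.seq_last {a b : ℝ} (P : Partition a b) : P.seq (P.n + 1) = b := by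
  refine Eq.trans ?_ P.last; unfold Partition.seq; congr 1
  ext; simp

lemma Partition.seq_castSucc {a b : ℝ} (P : Partition a b) (i : Fin (P.n + 1)) :
    P.pts i.castSucc = P.seq i := by
  unfold Partition.seq; congr 1
  ext; simp

lemma Partition.seq_succ {a b : ℝ} (P : Partition a b) (i : Fin (P.n + 1)) :
    P.pts i.succ = P.seq (i + 1) := by
  unfold Partition.seq; congr 1
  ext; simp; omega

lemma riemannSum_eq {V : Type*} [NormedAddCommGroup V] (Ξ : ℝ × ℝ → ℝ × ℝ → V) {a₁ b₁ a₂ b₂ : ℝ}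
    (P : Partition a₁ b₁) (Q : Partition a₂ b₂) :
    riemannSum Ξ P Q = ∑ i ∈ Finset.range (P.n + 1), ∑ j ∈ Finset.range (Q.n + 1),
      Ξ (P.seq i, Q.seq j) (P.seq (i+1), Q.seq (j+1)) := by
  unfold riemannSum
  rw [Finset.sum_range]
  refine Finset.sum_congr rfl fun i _ => ?_
  rw [Finset.sum_range]
  refine Finset.sum_congr rfl fun j _ => ?_
  rw [P.seq_castSucc, Q.seq_castSucc, P.seq_succ, Q.seq_succ]

lemma Partition.step_le {a b : ℝ} (P : Partition a b) {i : ℕ} (hi : i < P.n + 1) :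
    P.seq (i+1) - P.seq i ≤ P.mesh := by
  have := Finset.le_sup' (fun i : Fin (P.n + 1) => P.pts i.succ - P.pts i.castSucc)
    (Finset.mem_univ ⟨i, hi⟩)
  rwa [P.seq_castSucc, P.seq_succ] at this

lemma Partition.mesh_nonneg {a b : ℝ} (P : Partition a b) : 0 ≤ P.mesh :=
  (sub_nonneg.2 (P.seq_mono (Nat.le_succ 0))).trans (P.step_le (Nat.succ_pos _))

lemma Partition.sum_pow {a b : ℝ} (P : Partition a b) {r : ℝ} (hr : 1 < r) :
    ∑ i ∈ Finset.range (P.n + 1), (P.seq (i+1) - P.seq i) ^ r ≤ P.mesh ^ (r - 1) * (b - a) := by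
  calc _ ≤ ∑ i ∈ Finset.range (P.n + 1), P.mesh ^ (r - 1) * (P.seq (i+1) - P.seq i) := by
        refine Finset.sum_le_sum fun i hi => ?_
        have h0 : 0 ≤ P.seq (i+1) - P.seq i := sub_nonneg.2 (P.seq_mono (Nat.le_succ i))
        have h1 := P.step_le (Finset.mem_range.1 hi)
        have e : (P.seq (i+1) - P.seq i) ^ r
            = (P.seq (i+1) - P.seq i) ^ (r - 1) * (P.seq (i+1) - P.seq i) := by
          rcases h0.eq_or_lt with h | h
          · rw [← h, Real.zero_rpow (by linarith)]; simp
          · nth_rewrite 3 [← Real.rpow_one (P.seq (i+1) - P.seq i)]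
            rw [← Real.rpow_add h]; congr 1; ring
        rw [e]
        gcongr
    _ = _ := by
      rw [← Finset.mul_sum, Finset.sum_range_sub, P.seq_last, P.seq_zero]

lemma mem_Sq {T : ℝ} {s : ℝ × ℝ} : s ∈ Sq T ↔ s.1 ∈ Icc 0 T ∧ s.2 ∈ Icc 0 T := by
  unfold Sq
  simp only [mem_Icc, Prod.le_def]
  tauto

lemma tendsto_abs_rpow {ι : Type*} {l : Filter ι} {f : ι → ℝ} {a g : ℝ} (hg : 0 < g)
    (h : Tendsto f l (𝓝 a)) : Tendsto (fun i => |f i| ^ g) l (𝓝 (|a| ^ g)) :=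
  h.abs.rpow_const (Or.inr hg.le)

lemma A_tendsto {V : Type*} [NormedAddCommGroup V] [NormedSpace ℝ V] {T : ℝ}
    {γ : ℝ × ℝ} {η M : ℝ} (hg1 : 0 < γ.1) (hg2 : 0 < γ.2)
    {A : ℝ × ℝ → V → V} {DA : ℝ × ℝ → V → V →L[ℝ] V} {D2A : ℝ × ℝ → V → V →L[ℝ] V →L[ℝ] V}
    (hA : MemCtC2 T γ η A DA D2A M) {ι : Type*} {l : Filter ι}
    {σ τ : ι → ℝ} {s t : ℝ} (hσ : ∀ i, σ i ∈ Icc 0 T) (hτ : ∀ i, τ i ∈ Icc 0 T)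
    (hs : s ∈ Icc 0 T) (ht : t ∈ Icc 0 T) (h1 : Tendsto σ l (𝓝 s)) (h2 : Tendsto τ l (𝓝 t))
    {z : ι → V} {z0 : V} (h3 : Tendsto z l (𝓝 z0)) :
    Tendsto (fun i => A (σ i, τ i) (z i)) l (𝓝 (A (s, t) z0)) := by
  obtain ⟨D1, _, B, I1, I2, _⟩ := hA
  have b : ∀ i, ‖A (σ i, τ i) (z i) - A (s, t) z0‖ ≤
      M * |τ i - t| ^ γ.2 + M * |σ i - s| ^ γ.1 + M * ‖z i - z0‖ := by
    intro i
    have m1 : (σ i, t) ∈ Sq T := mem_Sq.2 ⟨hσ i, ht⟩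
    have m2 : (σ i, τ i) ∈ Sq T := mem_Sq.2 ⟨hσ i, hτ i⟩
    have m3 : (s, t) ∈ Sq T := mem_Sq.2 ⟨hs, ht⟩
    have e1 := (I2 _ m1 _ m2).1 (z i)
    have e2 := (I1 _ m3 _ m1).1 (z i)
    have e3 := lip_of_fderiv (D1 _ m3) (B _ m3).2.1 (z i) z0
    have e : A (σ i, τ i) (z i) - A (s, t) z0 = (A (σ i, τ i) (z i) - A (σ i, t) (z i))
        + (A (σ i, t) (z i) - A (s, t) (z i)) + (A (s, t) (z i) - A (s, t) z0) := by abel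
    rw [e]
    exact (norm_add₃_le).trans (add_le_add (add_le_add e1 e2) e3)
  rw [tendsto_iff_norm_sub_tendsto_zero]
  refine squeeze_zero (fun _ => norm_nonneg _) b ?_
  have t1 := tendsto_abs_rpow hg2 (h2.sub_const t)
  have t2 := tendsto_abs_rpow hg1 (h1.sub_const s)
  have t3 := (h3.sub_const z0).norm
  have := ((t1.const_mul M).add (t2.const_mul M)).add (t3.const_mul M)
  simpa [Real.zero_rpow hg1.ne', Real.zero_rpow hg2.ne'] using this

lemma box_tendsto {V : Type*} [NormedAddCommGroup V] [NormedSpace ℝ V] {T : ℝ}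
    {γ : ℝ × ℝ} {η M : ℝ} (hg1 : 0 < γ.1) (hg2 : 0 < γ.2)
    {A : ℝ × ℝ → V → V} {DA : ℝ × ℝ → V → V →L[ℝ] V} {D2A : ℝ × ℝ → V → V →L[ℝ] V →L[ℝ] V}
    (hA : MemCtC2 T γ η A DA D2A M) {ι : Type*} {l : Filter ι}
    {σ τ σ' τ' : ι → ℝ} {s t s' t' : ℝ} (hσ : ∀ i, σ i ∈ Icc 0 T) (hτ : ∀ i, τ i ∈ Icc 0 T)
    (hs : s ∈ Icc 0 T) (ht : t ∈ Icc 0 T) (h1 : Tendsto σ l (𝓝 s)) (h2 : Tendsto τ l (𝓝 t))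
    (hσ' : ∀ i, σ' i ∈ Icc 0 T) (hτ' : ∀ i, τ' i ∈ Icc 0 T)
    (hs' : s' ∈ Icc 0 T) (ht' : t' ∈ Icc 0 T) (h1' : Tendsto σ' l (𝓝 s'))
    (h2' : Tendsto τ' l (𝓝 t'))
    {z : ι → V} {z0 : V} (h3 : Tendsto z l (𝓝 z0)) :
    Tendsto (fun i => box (fun r => A r (z i)) (σ i, τ i) (σ' i, τ' i)) l
      (𝓝 (box (fun r => A r z0) (s, t) (s', t'))) := by
  unfold box
  have q1 := A_tendsto hg1 hg2 hA hσ' hτ' hs' ht' h1' h2' h3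
  have q2 := A_tendsto hg1 hg2 hA hσ' hτ hs' ht h1' h2 h3
  have q3 := A_tendsto hg1 hg2 hA hσ hτ' hs ht' h1 h2' h3
  have q4 := A_tendsto hg1 hg2 hA hσ hτ hs ht h1 h2 h3
  exact ((q1.sub q2).sub q3).add q4


lemma EulerSol.a1 {V : Type*} [NormedAddCommGroup V] {A : ℝ × ℝ → V → V} {ξ : ℝ × ℝ → V}
    {g1 g2 K : ℝ} {x : ℕ → ℝ} (hx : Monotone x) {n : ℕ} {θ : ℕ → ℕ → V}
    (h : EulerSol A ξ g1 g2 K x n θ) {i k v : ℕ} (hi : i ≤ n) (hk : k ≤ n) (hv : v ≤ n) :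
    ‖θ k v - θ i v‖ ≤ K * |x k - x i| ^ g1 := by
  rcases le_total i k with q | q
  · rw [abs_of_nonneg (sub_nonneg.2 (hx q))]; exact h.k1 _ _ _ q hk hv
  · rw [norm_sub_rev, abs_sub_comm, abs_of_nonneg (sub_nonneg.2 (hx q))]; exact h.k1 _ _ _ q hi hv

lemma EulerSol.a2 {V : Type*} [NormedAddCommGroup V] {A : ℝ × ℝ → V → V} {ξ : ℝ × ℝ → V}
    {g1 g2 K : ℝ} {x : ℕ → ℝ} (hx : Monotone x) {n : ℕ} {θ : ℕ → ℕ → V}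
    (h : EulerSol A ξ g1 g2 K x n θ) {j l u : ℕ} (hj : j ≤ n) (hl : l ≤ n) (hu : u ≤ n) :
    ‖θ u l - θ u j‖ ≤ K * |x l - x j| ^ g2 := by
  rcases le_total j l with q | q
  · rw [abs_of_nonneg (sub_nonneg.2 (hx q))]; exact h.k2 _ _ _ q hl hu
  · rw [norm_sub_rev, abs_sub_comm, abs_of_nonneg (sub_nonneg.2 (hx q))]; exact h.k2 _ _ _ q hj hu

lemma EulerSol.a12 {V : Type*} [NormedAddCommGroup V] {A : ℝ × ℝ → V → V} {ξ : ℝ × ℝ → V}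
    {g1 g2 K : ℝ} {x : ℕ → ℝ} (hx : Monotone x) {n : ℕ} {θ : ℕ → ℕ → V}
    (h : EulerSol A ξ g1 g2 K x n θ) {i k j l : ℕ} (hi : i ≤ n) (hk : k ≤ n) (hj : j ≤ n)
    (hl : l ≤ n) :
    ‖θ k l - θ k j - θ i l + θ i j‖ ≤ K * |x k - x i| ^ g1 * |x l - x j| ^ g2 := by
  have aux : ∀ i k j l, i ≤ n → k ≤ n → j ≤ n → l ≤ n → i ≤ k →
      ‖θ k l - θ k j - θ i l + θ i j‖ ≤ K * |x k - x i| ^ g1 * |x l - x j| ^ g2 := by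
    intro i k j l hi hk hj hl q
    rcases le_total j l with r | r
    · rw [abs_of_nonneg (sub_nonneg.2 (hx q)), abs_of_nonneg (sub_nonneg.2 (hx r))]
      exact h.k12 _ _ _ _ q hk r hl
    · rw [abs_of_nonneg (sub_nonneg.2 (hx q)), abs_sub_comm,
        abs_of_nonneg (sub_nonneg.2 (hx r)), ← norm_neg]
      have e : -(θ k l - θ k j - θ i l + θ i j) = θ k j - θ k l - θ i j + θ i l := by abel
      rw [e]
      exact h.k12 _ _ _ _ q hk r hj
  rcases le_total i k with q | q
  · exact aux i k j l hi hk hj hl q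
  · rw [abs_sub_comm (x k), ← norm_neg]
    have e : -(θ k l - θ k j - θ i l + θ i j) = θ i l - θ i j - θ k l + θ k j := by abel
    rw [e]
    exact aux k i j l hk hi hj hl q

lemma exists_solution {V : Type*} [NormedAddCommGroup V] [NormedSpace ℝ V] [ProperSpace V] {T : ℝ}
    (hT : 0 < T) {γ : ℝ × ℝ} {η M : ℝ} (hg1 : 1/2 < γ.1) (hg2 : 1/2 < γ.2)
    {A : ℝ × ℝ → V → V} {DA : ℝ × ℝ → V → V →L[ℝ] V} {D2A : ℝ × ℝ → V → V →L[ℝ] V →L[ℝ] V}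
    (hM : 0 ≤ M) (hA : MemCtC2 T γ η A DA D2A M) {ξ : ℝ × ℝ → V} (hξ : MemHolder (Sq T) γ ξ)
    (hξbox : ∀ s ∈ Sq T, ∀ t ∈ Sq T, s ≤ t → box ξ s t = 0) :
    ∃ θ : ℝ × ℝ → V, MemHolder (Sq T) γ θ ∧
        ∀ t ∈ Sq T, SewsTo (nlyGerm A θ) (0, 0) t (θ t - ξ t) := by
  have g1 : 0 < γ.1 := by linarith
  have g2 : 0 < γ.2 := by linarith
  obtain ⟨L, hL, x1, x2, x12⟩ := (memHolder_iff g1 g2 ξ).1 hξ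
  obtain ⟨N, K, hN, hK, hE⟩ := euler_exists hT hg1 hg2 hM hA hL x1 x2
  choose Θ hΘ using fun k : ℕ => hE (k + 1) (Nat.succ_pos k)
  set n : ℕ → ℕ := fun k => N * (k + 1) with hn
  have hn0 : ∀ k, 0 < n k := fun k => Nat.mul_pos hN (Nat.succ_pos k)
  set a : ℕ → ℝ → ℕ := fun k s => ⌊s * n k / T⌋₊ with ha
  set X : ℕ → ℝ → ℝ := fun k s => grid T (n k) (a k s) with hX
  have hΘ' : ∀ k, EulerSol A ξ γ.1 γ.2 K (grid T (n k)) (n k) (Θ k) := hΘ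
  have gm : ∀ k, Monotone (grid T (n k)) := fun k => grid_mono hT _
  have aN : ∀ k, ∀ s ∈ Icc 0 T, a k s ≤ n k := fun k s hs => (grid_floor hT (hn0 k) hs).1
  have am : ∀ k, Monotone (a k) := by
    intro k s t h
    apply Nat.floor_le_floor
    gcongr
  have a0 : ∀ k, a k 0 = 0 := by intro k; simp [ha]
  have XT : ∀ k s, X k s ∈ Icc 0 T := fun k s => grid_mem hT _ _
  set U : Ultrafilter ℕ := hyperfilter ℕ
  have hU : (U : Filter ℕ) ≤ atTop := Nat.hyperfilter_le_atTop
  have Xlim : ∀ s ∈ Icc 0 T, Tendsto (fun k => X k s) U (𝓝 s) := by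
    intro s hs
    refine Tendsto.mono_left ?_ hU
    rw [tendsto_iff_norm_sub_tendsto_zero]
    refine squeeze_zero (fun _ => norm_nonneg _) (fun k => (grid_floor hT (hn0 k) hs).2) ?_
    have h1 : Tendsto n atTop atTop := by
      refine tendsto_atTop_mono (fun k => ?_) tendsto_id
      show k ≤ N * (k + 1)
      nlinarith
    exact (tendsto_const_div_atTop_nhds_zero_nat T).comp h1
  have bd : ∀ k i j, i ≤ n k → j ≤ n k →
      ‖Θ k i j‖ ≤ K * T ^ γ.1 + K * T ^ γ.2 + ‖ξ (0, 0)‖ := by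
    intro k i j hi hj
    have e : Θ k i j = (Θ k i j - Θ k 0 j) + (Θ k 0 j - Θ k 0 0) + Θ k 0 0 := by abel
    rw [e]
    have z0 : grid T (n k) 0 = 0 := grid_zero hT _
    have r1 := (hΘ' k).k1 0 i j (Nat.zero_le _) hi hj
    have r2 := (hΘ' k).k2 0 j 0 (Nat.zero_le _) hj (Nat.zero_le _)
    have r3 : Θ k 0 0 = ξ (0, 0) := by rw [(hΘ' k).b1, z0]
    rw [z0, sub_zero] at r1 r2
    have i1 := grid_mem hT (n k) i
    have j1 := grid_mem hT (n k) j
    refine norm_add₃_le.trans (add_le_add (add_le_add (r1.trans ?_) (r2.trans ?_)) (by rw [r3]))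
    · gcongr
      exacts [i1.1, i1.2]
    · gcongr
      exacts [j1.1, j1.2]
  have lim : ∀ t : ℝ × ℝ, ∃ v, t ∈ Sq T →
      Tendsto (fun k => Θ k (a k t.1) (a k t.2)) U (𝓝 v) := by
    intro t
    by_cases ht : t ∈ Sq T
    · have ht' := mem_Sq.1 ht
      obtain ⟨v, _, hv⟩ := (isCompact_closedBall (0:V)
        (K * T ^ γ.1 + K * T ^ γ.2 + ‖ξ (0, 0)‖)).ultrafilter_le_nhds
          (U.map fun k => Θ k (a k t.1) (a k t.2)) (by
            rw [le_principal_iff]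
            refine Filter.mem_map.2 (Filter.univ_mem' fun k => ?_)
            refine mem_closedBall_zero_iff.2 ?_
            exact bd k _ _ (aN k _ ht'.1) (aN k _ ht'.2))
      exact ⟨v, fun _ => hv⟩
    · exact ⟨0, fun h => absurd h ht⟩
  choose θ hθ using lim
  have hθ' : ∀ s t, s ∈ Icc 0 T → t ∈ Icc 0 T →
      Tendsto (fun k => Θ k (a k s) (a k t)) U (𝓝 (θ (s, t))) :=
    fun s t hs ht => hθ (s, t) (mem_Sq.2 ⟨hs, ht⟩)
  have ξ1 : ∀ s ∈ Icc 0 T, ∀ t ∈ Icc 0 T, ‖ξ (s, 0) - ξ (t, 0)‖ ≤ L * |s - t| ^ γ.1 := by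
    intro s hs t ht
    exact x1 (t, 0) (mem_Sq.2 ⟨ht, le_rfl, hT.le⟩) (s, 0) (mem_Sq.2 ⟨hs, le_rfl, hT.le⟩)
  have ξ2 : ∀ s ∈ Icc 0 T, ∀ t ∈ Icc 0 T, ‖ξ (0, s) - ξ (0, t)‖ ≤ L * |s - t| ^ γ.2 := by
    intro s hs t ht
    exact x2 (0, t) (mem_Sq.2 ⟨⟨le_rfl, hT.le⟩, ht⟩) (0, s) (mem_Sq.2 ⟨⟨le_rfl, hT.le⟩, hs⟩)
  have l1 : ∀ s ∈ Icc 0 T, Tendsto (fun k => Θ k (a k s) 0) U (𝓝 (ξ (s, 0))) := by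
    intro s hs
    rw [tendsto_iff_norm_sub_tendsto_zero]
    refine squeeze_zero (g := fun k => L * |X k s - s| ^ γ.1) (fun _ => norm_nonneg _)
      (fun k => ?_) ?_
    · rw [(hΘ' k).b1]; exact ξ1 _ (XT k s) _ hs
    · have := (tendsto_abs_rpow g1 ((Xlim s hs).sub_const s)).const_mul L
      simpa [Real.zero_rpow g1.ne'] using this
  have l2 : ∀ s ∈ Icc 0 T, Tendsto (fun k => Θ k 0 (a k s)) U (𝓝 (ξ (0, s))) := by
    intro s hs
    rw [tendsto_iff_norm_sub_tendsto_zero]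
    refine squeeze_zero (g := fun k => L * |X k s - s| ^ γ.2) (fun _ => norm_nonneg _)
      (fun k => ?_) ?_
    · rw [(hΘ' k).b2]; exact ξ2 _ (XT k s) _ hs
    · have := (tendsto_abs_rpow g2 ((Xlim s hs).sub_const s)).const_mul L
      simpa [Real.zero_rpow g2.ne'] using this
  have l0 : Tendsto (fun k => Θ k 0 0) U (𝓝 (ξ (0, 0))) := by
    have := l1 0 ⟨le_rfl, hT.le⟩
    simpa only [a0] using this
  refine ⟨θ, (memHolder_iff g1 g2 θ).2 ⟨K, hK, ?_, ?_, ?_⟩, ?_⟩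
  · intro s hs t ht
    rw [mem_Sq] at hs ht
    refine le_of_tendsto_of_tendsto ((hθ' _ _ ht.1 hs.2).sub (hθ' _ _ hs.1 hs.2)).norm
      ((tendsto_abs_rpow g1 ((Xlim _ ht.1).sub (Xlim _ hs.1))).const_mul K)
      (Filter.Eventually.of_forall fun k => ?_)
    exact (hΘ' k).a1 (gm k) (aN k _ hs.1) (aN k _ ht.1) (aN k _ hs.2)
  · intro s hs t ht
    rw [mem_Sq] at hs ht
    refine le_of_tendsto_of_tendsto ((hθ' _ _ hs.1 ht.2).sub (hθ' _ _ hs.1 hs.2)).norm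
      ((tendsto_abs_rpow g2 ((Xlim _ ht.2).sub (Xlim _ hs.2))).const_mul K)
      (Filter.Eventually.of_forall fun k => ?_)
    exact (hΘ' k).a2 (gm k) (aN k _ hs.2) (aN k _ ht.2) (aN k _ hs.1)
  · intro s hs t ht
    rw [mem_Sq] at hs ht
    refine le_of_tendsto_of_tendsto ((((hθ' _ _ ht.1 ht.2).sub (hθ' _ _ ht.1 hs.2)).sub
        (hθ' _ _ hs.1 ht.2)).add (hθ' _ _ hs.1 hs.2)).norm
      (((tendsto_abs_rpow g1 ((Xlim _ ht.1).sub (Xlim _ hs.1))).const_mul K).mul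
        (tendsto_abs_rpow g2 ((Xlim _ ht.2).sub (Xlim _ hs.2))))
      (Filter.Eventually.of_forall fun k => ?_)
    exact (hΘ' k).a12 (gm k) (aN k _ hs.1) (aN k _ ht.1) (aN k _ hs.2) (aN k _ ht.2)
  -- the equation
  intro t ht
  have ht' := mem_Sq.1 ht
  set c1 := kap (2 * γ.1) * (M * K * T ^ γ.2
    + kap (2 * γ.2) * (M * (K + K * K)) * T ^ (2 * γ.2)) with hc1
  set c2 := kap (2 * γ.2) * (M * K * T ^ γ.1
    + kap (2 * γ.1) * (M * (K + K * K)) * T ^ (2 * γ.1)) with hc2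
  have κ1 := kap_pos (p := 2 * γ.1) (by linarith)
  have κ2 := kap_pos (p := 2 * γ.2) (by linarith)
  have hc1' : 0 ≤ c1 := by positivity
  have hc2' : 0 ≤ c2 := by positivity
  have key : ∀ (P : Partition 0 t.1) (Q : Partition 0 t.2),
      ‖(θ t - ξ t) - riemannSum (nlyGerm A θ) P Q‖ ≤
        c1 * (P.mesh ^ (2 * γ.1 - 1) * (t.1 - 0)) + c2 * (Q.mesh ^ (2 * γ.2 - 1) * (t.2 - 0)) := by
    intro P Q
    have pT : ∀ i, P.seq i ∈ Icc 0 T := by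
      intro i
      have h1 := P.seq_mono (Nat.zero_le i)
      have h2 := P.seq_mono (le_max_left i (P.n + 1))
      have h3 : P.seq (max i (P.n + 1)) = t.1 := by
        refine Eq.trans ?_ P.seq_last
        unfold Partition.seq; congr 2; omega
      rw [P.seq_zero] at h1
      exact ⟨h1, by linarith [ht'.1.2]⟩
    have qT : ∀ i, Q.seq i ∈ Icc 0 T := by
      intro i
      have h1 := Q.seq_mono (Nat.zero_le i)
      have h2 := Q.seq_mono (le_max_left i (Q.n + 1))
      have h3 : Q.seq (max i (Q.n + 1)) = t.2 := by
        refine Eq.trans ?_ Q.seq_last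
        unfold Partition.seq; congr 2; omega
      rw [Q.seq_zero] at h1
      exact ⟨h1, by linarith [ht'.2.2]⟩
    have C := fun k => (hΘ' k).coarse hT hg1 hg2 hM hA hK (α := fun i => a k (P.seq i))
      (β := fun j => a k (Q.seq j)) ((am k).comp P.seq_mono) (by simp only [P.seq_zero, a0])
      ((am k).comp Q.seq_mono) (by simp only [Q.seq_zero, a0]) (q := P.n + 1) (r := Q.n + 1)
      (aN k _ (pT _)) (aN k _ (qT _))
    have L1 : Tendsto (fun k => (Θ k (a k (P.seq (P.n+1))) (a k (Q.seq (Q.n+1)))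
        - Θ k (a k (P.seq (P.n+1))) 0 - Θ k 0 (a k (Q.seq (Q.n+1))) + Θ k 0 0)
        - ∑ i ∈ Finset.range (P.n+1), ∑ j ∈ Finset.range (Q.n+1),
          box (fun r => A r (Θ k (a k (P.seq i)) (a k (Q.seq j)))) (X k (P.seq i), X k (Q.seq j))
          (X k (P.seq (i+1)), X k (Q.seq (j+1)))) U
        (𝓝 ((θ (P.seq (P.n+1), Q.seq (Q.n+1)) - ξ (P.seq (P.n+1), 0) - ξ (0, Q.seq (Q.n+1))
          + ξ (0,0)) - ∑ i ∈ Finset.range (P.n+1), ∑ j ∈ Finset.range (Q.n+1),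
          box (fun r => A r (θ (P.seq i, Q.seq j))) (P.seq i, Q.seq j)
          (P.seq (i+1), Q.seq (j+1)))) := by
      refine Tendsto.sub ((((hθ' _ _ (pT _) (qT _)).sub (l1 _ (pT _))).sub (l2 _ (qT _))).add l0) ?_
      refine tendsto_finsetSum _ fun i _ => tendsto_finsetSum _ fun j _ => ?_
      exact box_tendsto g1 g2 hA (fun k => XT k _) (fun k => XT k _) (pT _) (qT _)
        (Xlim _ (pT _)) (Xlim _ (qT _)) (fun k => XT k _) (fun k => XT k _) (pT _) (qT _)
        (Xlim _ (pT _)) (Xlim _ (qT _)) (hθ' _ _ (pT _) (qT _))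
    have S1 : ∀ {b : ℝ} (S : Partition 0 b) (g : ℝ), 0 < g → (∀ i, S.seq i ∈ Icc 0 T) →
        Tendsto (fun k => ∑ i ∈ Finset.range (S.n+1), (X k (S.seq (i+1)) - X k (S.seq i)) ^ g) U
          (𝓝 (∑ i ∈ Finset.range (S.n+1), (S.seq (i+1) - S.seq i) ^ g)) := by
      intro b S g hg hS
      refine tendsto_finsetSum _ fun i _ => ?_
      exact ((Xlim _ (hS _)).sub (Xlim _ (hS _))).rpow_const (Or.inr hg.le)
    have fin := le_of_tendsto_of_tendsto L1.norm
      (((S1 P (2 * γ.1) (by linarith) pT).const_mul c1).add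
        ((S1 Q (2 * γ.2) (by linarith) qT).const_mul c2)) (Filter.Eventually.of_forall C)
    have bx := hξbox (0,0) (mem_Sq.2 ⟨⟨le_rfl, hT.le⟩, ⟨le_rfl, hT.le⟩⟩) t ht ht.1
    unfold box at bx
    have e : θ t - ξ t = θ (t.1, t.2) - ξ (t.1, 0) - ξ (0, t.2) + ξ (0, 0) := by
      have e2 : ξ (t.1, t.2) = ξ (t.1, 0) + ξ (0, t.2) - ξ (0, 0) := by
        rw [← sub_eq_zero, ← bx]; simp only; abel
      rw [show ξ t = ξ (t.1, t.2) from rfl, e2]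
      show θ (t.1, t.2) - _ = _
      abel
    rw [riemannSum_eq, e]
    rw [P.seq_last, Q.seq_last] at fin
    refine fin.trans ?_
    have s1 := P.sum_pow (r := 2 * γ.1) (by linarith)
    have s2 := Q.sum_pow (r := 2 * γ.2) (by linarith)
    gcongr
  intro P Q hPQ
  rw [tendsto_iff_norm_sub_tendsto_zero]
  have mP : Tendsto (fun k => (P k).mesh) atTop (𝓝 0) :=
    squeeze_zero (fun k => (P k).mesh_nonneg) (fun k => le_max_left _ _) hPQ
  have mQ : Tendsto (fun k => (Q k).mesh) atTop (𝓝 0) :=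
    squeeze_zero (fun k => (Q k).mesh_nonneg) (fun k => le_max_right _ _) hPQ
  refine squeeze_zero (fun _ => norm_nonneg _)
    (fun k => (norm_sub_rev _ _).le.trans (key (P k) (Q k))) ?_
  have w1 := mP.rpow_const (p := 2 * γ.1 - 1) (Or.inr (by linarith))
  have w2 := mQ.rpow_const (p := 2 * γ.2 - 1) (Or.inr (by linarith))
  rw [Real.zero_rpow (by linarith)] at w1 w2
  have := ((w1.mul_const (t.1 - 0)).const_mul c1).add ((w2.mul_const (t.2 - 0)).const_mul c2)
  simpa using this


/-- The partition given by a monotone sequence. -/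
def Partition.ofSeq (x : ℕ → ℝ) (hx : Monotone x) (n : ℕ) {a b : ℝ} (ha : x 0 = a)
    (hb : x (n + 1) = b) : Partition a b where
  n := n
  pts := fun i => x i
  mono := fun i k h => hx (by exact_mod_cast h)
  first := by simpa using ha
  last := by simpa using hb

lemma SewsTo.seq {V : Type*} [NormedAddCommGroup V] {Ξ : ℝ × ℝ → ℝ × ℝ → V} {t : ℝ × ℝ} {L : V}
    (h : SewsTo Ξ (0, 0) t L) {x y : ℕ → ℕ → ℝ} (hx : ∀ k, Monotone (x k))
    (hy : ∀ k, Monotone (y k)) {m m' : ℕ → ℕ} (x0 : ∀ k, x k 0 = 0) (y0 : ∀ k, y k 0 = 0)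
    (x1 : ∀ k, x k (m k + 1) = t.1) (y1 : ∀ k, y k (m' k + 1) = t.2) {ε : ℕ → ℝ}
    (hε : Tendsto ε atTop (𝓝 0)) (sx : ∀ k i, x k (i + 1) - x k i ≤ ε k)
    (sy : ∀ k i, y k (i + 1) - y k i ≤ ε k) :
    Tendsto (fun k => ∑ i ∈ Finset.range (m k + 1), ∑ j ∈ Finset.range (m' k + 1),
      Ξ (x k i, y k j) (x k (i+1), y k (j+1))) atTop (𝓝 L) := by
  have := h (fun k => Partition.ofSeq (x k) (hx k) (m k) (x0 k) (x1 k))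
    (fun k => Partition.ofSeq (y k) (hy k) (m' k) (y0 k) (y1 k)) ?_
  · refine this.congr fun k => ?_
    unfold riemannSum
    rw [Finset.sum_range]
    refine Finset.sum_congr rfl fun i _ => ?_
    rw [Finset.sum_range]
    refine Finset.sum_congr rfl fun j _ => ?_
    rfl
  · refine squeeze_zero (fun k => (Partition.mesh_nonneg _).trans (le_max_left _ _))
      (fun k => ?_) hε
    refine max_le ?_ ?_
    · refine Finset.sup'_le _ _ fun i _ => ?_
      exact sx k i
    · refine Finset.sup'_le _ _ fun i _ => ?_
      exact sy k i

lemma grid_mono' {S : ℝ} (hS : 0 ≤ S) (n : ℕ) : Monotone (grid S n) := by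
  intro i k h
  have : (i:ℝ) ≤ k := by exact_mod_cast h
  unfold grid
  gcongr

lemma grid_succ' {S : ℝ} (hS : 0 ≤ S) (n i : ℕ) : grid S n (i + 1) - grid S n i ≤ S / n := by
  have p : 0 ≤ S / n := by positivity
  unfold grid
  push_cast
  rcases le_total ((i:ℝ) * (S / n)) S with q | q
  · rw [min_eq_left q]
    linarith [min_le_left (((i:ℝ) + 1) * (S / n)) S]
  · rw [min_eq_right q]
    linarith [min_le_right (((i:ℝ) + 1) * (S / n)) S]

lemma grid_zero' {S : ℝ} (hS : 0 ≤ S) (n : ℕ) : grid S n 0 = 0 := by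
  simp [grid, hS]

lemma grid_top {S : ℝ} (hS : 0 ≤ S) {n i : ℕ} (hn : 0 < n) (h : n ≤ i) : grid S n i = S := by
  unfold grid
  apply min_eq_right
  have h' : (n:ℝ) ≤ i := by exact_mod_cast h
  have hn' : (0:ℝ) < n := by exact_mod_cast hn
  calc S = n * (S / n) := by field_simp
    _ ≤ _ := by gcongr

/-- A sequence running from `0` to `s` in `n` steps and from `s` to `t` in `n` steps. -/
def dseq (s t : ℝ) (n i : ℕ) : ℝ := grid s n i + grid (t - s) n (i - n)

lemma dseq_mono {s t : ℝ} (hs : 0 ≤ s) (hst : s ≤ t) (n : ℕ) : Monotone (dseq s t n) := by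
  intro i k h
  exact add_le_add (grid_mono' hs n h) (grid_mono' (sub_nonneg.2 hst) n (Nat.sub_le_sub_right h n))

lemma dseq_zero {s t : ℝ} (hs : 0 ≤ s) (hst : s ≤ t) (n : ℕ) : dseq s t n 0 = 0 := by
  simp [dseq, grid_zero' hs, grid_zero' (sub_nonneg.2 hst)]

lemma dseq_mid {s t : ℝ} (hs : 0 ≤ s) (hst : s ≤ t) {n : ℕ} (hn : 0 < n) : dseq s t n n = s := by
  simp [dseq, grid_top hs hn le_rfl, grid_zero' (sub_nonneg.2 hst)]

lemma dseq_top {s t : ℝ} (hs : 0 ≤ s) (hst : s ≤ t) {n i : ℕ} (hn : 0 < n) (hi : 2 * n ≤ i) :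
    dseq s t n i = t := by
  rw [dseq, grid_top hs hn (by omega), grid_top (sub_nonneg.2 hst) hn (by omega)]; ring

lemma dseq_mem {s t T : ℝ} (hs : 0 ≤ s) (hst : s ≤ t) (ht : t ≤ T) {n : ℕ} (hn : 0 < n) (i : ℕ) :
    dseq s t n i ∈ Icc 0 T := by
  have h1 := dseq_mono hs hst n (Nat.zero_le i)
  have h2 := dseq_mono hs hst n (le_max_left i (2 * n))
  rw [dseq_zero hs hst] at h1
  rw [dseq_top hs hst hn (le_max_right i (2 * n))] at h2
  exact ⟨h1, h2.trans ht⟩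

lemma dseq_step {s t T : ℝ} (hs : 0 ≤ s) (hst : s ≤ t) (ht : t ≤ T) (n i : ℕ) :
    dseq s t n (i + 1) - dseq s t n i ≤ T / n := by
  have h1 := grid_succ' hs n i
  have h2 : grid (t - s) n (i + 1 - n) - grid (t - s) n (i - n) ≤ (t - s) / n := by
    have hts := sub_nonneg.2 hst
    rcases le_or_gt n i with h | h
    · rw [Nat.sub_add_comm h]; exact grid_succ' hts n _
    · rw [show i + 1 - n = 0 by omega, show i - n = 0 by omega, sub_self]; positivity
  have h3 : s / n + (t - s) / n ≤ T / n := by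
    rw [← add_div]; gcongr; linarith
  unfold dseq
  linarith

lemma sum_Ico_Ico {V : Type*} [AddCommGroup V] (f : ℕ → ℕ → V) {a b c d : ℕ} (hab : a ≤ b)
    (hcd : c ≤ d) : ∑ i ∈ Finset.Ico a b, ∑ j ∈ Finset.Ico c d, f i j =
      ∑ i ∈ Finset.range b, ∑ j ∈ Finset.range d, f i j
      - ∑ i ∈ Finset.range b, ∑ j ∈ Finset.range c, f i j
      - ∑ i ∈ Finset.range a, ∑ j ∈ Finset.range d, f i j
      + ∑ i ∈ Finset.range a, ∑ j ∈ Finset.range c, f i j := by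
  simp only [Finset.sum_Ico_eq_sub _ hab, Finset.sum_Ico_eq_sub _ hcd, Finset.sum_sub_distrib]
  abel

lemma eps_tendsto (T : ℝ) : Tendsto (fun k : ℕ => T / ((k + 1 : ℕ) : ℝ)) atTop (𝓝 0) :=
  (tendsto_const_div_atTop_nhds_zero_nat T).comp (tendsto_add_atTop_nat 1)

lemma box_limit {V : Type*} [NormedAddCommGroup V] [NormedSpace ℝ V] {T : ℝ}
    {A : ℝ × ℝ → V → V} {ξ θ : ℝ × ℝ → V}
    (hξbox : ∀ s ∈ Sq T, ∀ t ∈ Sq T, s ≤ t → box ξ s t = 0)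
    (h : ∀ t ∈ Sq T, SewsTo (nlyGerm A θ) (0, 0) t (θ t - ξ t)) {s t : ℝ × ℝ} (hs : s ∈ Sq T)
    (ht : t ∈ Sq T) (hst : s ≤ t) :
    Tendsto (fun k : ℕ => ∑ i ∈ Finset.Ico (k + 1) (2 * (k + 1)),
        ∑ j ∈ Finset.Ico (k + 1) (2 * (k + 1)),
        nlyGerm A θ (dseq s.1 t.1 (k+1) i, dseq s.2 t.2 (k+1) j)
          (dseq s.1 t.1 (k+1) (i+1), dseq s.2 t.2 (k+1) (j+1))) atTop (𝓝 (box θ s t)) := by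
  have hs' := mem_Sq.1 hs
  have ht' := mem_Sq.1 ht
  have s1 := hs'.1.1
  have s2 := hs'.2.1
  have st1 := hst.1
  have st2 := hst.2
  have q : ∀ (r : ℝ × ℝ) (m m' : ℕ → ℕ), r ∈ Sq T → (∀ k, dseq s.1 t.1 (k+1) (m k + 1) = r.1) →
      (∀ k, dseq s.2 t.2 (k+1) (m' k + 1) = r.2) →
      Tendsto (fun k => ∑ i ∈ Finset.range (m k + 1), ∑ j ∈ Finset.range (m' k + 1),
        nlyGerm A θ (dseq s.1 t.1 (k+1) i, dseq s.2 t.2 (k+1) j)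
          (dseq s.1 t.1 (k+1) (i+1), dseq s.2 t.2 (k+1) (j+1))) atTop (𝓝 (θ r - ξ r)) := by
    intro r m m' hr h1 h2
    exact (h r hr).seq (x := fun k => dseq s.1 t.1 (k+1)) (y := fun k => dseq s.2 t.2 (k+1))
      (fun k => dseq_mono s1 st1 _) (fun k => dseq_mono s2 st2 _) (fun k => dseq_zero s1 st1 _)
      (fun k => dseq_zero s2 st2 _) h1 h2 (eps_tendsto T)
      (fun k i => dseq_step s1 st1 ht'.1.2 _ _) (fun k i => dseq_step s2 st2 ht'.2.2 _ _)
  have e1 : ∀ k : ℕ, dseq s.1 t.1 (k+1) (2 * k + 1 + 1) = t.1 :=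
    fun k => dseq_top s1 st1 (Nat.succ_pos _) (by omega)
  have e2 : ∀ k : ℕ, dseq s.2 t.2 (k+1) (2 * k + 1 + 1) = t.2 :=
    fun k => dseq_top s2 st2 (Nat.succ_pos _) (by omega)
  have f1 : ∀ k : ℕ, dseq s.1 t.1 (k+1) (k + 1) = s.1 := fun k => dseq_mid s1 st1 (Nat.succ_pos _)
  have f2 : ∀ k : ℕ, dseq s.2 t.2 (k+1) (k + 1) = s.2 := fun k => dseq_mid s2 st2 (Nat.succ_pos _)
  have q1 := q (t.1, t.2) (fun k => 2 * k + 1) (fun k => 2 * k + 1) ht e1 e2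
  have q2 := q (t.1, s.2) (fun k => 2 * k + 1) (fun k => k) (mem_Sq.2 ⟨ht'.1, hs'.2⟩) e1 f2
  have q3 := q (s.1, t.2) (fun k => k) (fun k => 2 * k + 1) (mem_Sq.2 ⟨hs'.1, ht'.2⟩) f1 e2
  have q4 := q (s.1, s.2) (fun k => k) (fun k => k) hs f1 f2
  have e : box θ s t = (θ (t.1, t.2) - ξ (t.1, t.2)) - (θ (t.1, s.2) - ξ (t.1, s.2))
      - (θ (s.1, t.2) - ξ (s.1, t.2)) + (θ (s.1, s.2) - ξ (s.1, s.2)) := by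
    have := hξbox s hs t ht hst
    rw [← sub_zero (box θ s t), ← this]
    unfold box
    abel
  rw [e]
  refine (((q1.sub q2).sub q3).add q4).congr fun k => ?_
  rw [sum_Ico_Ico _ (by omega) (by omega)]
  rfl

lemma axis1 {V : Type*} [NormedAddCommGroup V] {T : ℝ} (hT : 0 < T)
    {A : ℝ × ℝ → V → V} {ξ θ : ℝ × ℝ → V}
    (h : ∀ t ∈ Sq T, SewsTo (nlyGerm A θ) (0, 0) t (θ t - ξ t)) {t : ℝ} (ht : t ∈ Icc 0 T) :
    θ (t, 0) = ξ (t, 0) := by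
  have := (h (t, 0) (mem_Sq.2 ⟨ht, le_rfl, hT.le⟩)).seq (x := fun k => dseq 0 t (k+1))
    (y := fun _ _ => 0) (fun k => dseq_mono le_rfl ht.1 _) (fun k => monotone_const)
    (m := fun k => 2 * k + 1) (m' := fun k => k)
    (fun k => dseq_zero le_rfl ht.1 _) (fun k => rfl)
    (fun k => dseq_top le_rfl ht.1 (Nat.succ_pos _) (by omega))
    (fun k => rfl) (eps_tendsto T)
      (fun k i => dseq_step le_rfl ht.1 ht.2 _ _) (fun k i => by rw [sub_self]; positivity)
  simp only [nlyGerm, box, sub_self, zero_sub, neg_add_cancel, Finset.sum_const_zero] at this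
  have := tendsto_nhds_unique this tendsto_const_nhds
  exact sub_eq_zero.1 this

lemma axis2 {V : Type*} [NormedAddCommGroup V] {T : ℝ} (hT : 0 < T)
    {A : ℝ × ℝ → V → V} {ξ θ : ℝ × ℝ → V}
    (h : ∀ t ∈ Sq T, SewsTo (nlyGerm A θ) (0, 0) t (θ t - ξ t)) {t : ℝ} (ht : t ∈ Icc 0 T) :
    θ (0, t) = ξ (0, t) := by
  have := (h (0, t) (mem_Sq.2 ⟨⟨le_rfl, hT.le⟩, ht⟩)).seq (y := fun k => dseq 0 t (k+1))
    (x := fun _ _ => 0) (fun k => monotone_const) (fun k => dseq_mono le_rfl ht.1 _)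
    (m' := fun k => 2 * k + 1) (m := fun k => k) (fun k => rfl)
    (fun k => dseq_zero le_rfl ht.1 _) (fun k => rfl)
    (fun k => dseq_top le_rfl ht.1 (Nat.succ_pos _) (by omega)) (eps_tendsto T)
      (fun k i => by rw [sub_self]; positivity) (fun k i => dseq_step le_rfl ht.1 ht.2 _ _)
  simp only [nlyGerm, box, sub_sub_cancel_left, neg_add_cancel, Finset.sum_const_zero] at this
  have := tendsto_nhds_unique this tendsto_const_nhds
  exact sub_eq_zero.1 this


set_option maxHeartbeats 4000000 in
lemma contract {V : Type*} [NormedAddCommGroup V] [NormedSpace ℝ V] {η g1 g2 M K B h : ℝ}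
    {x y : ℕ → ℝ} {Φ : ℕ → ℕ → ℕ → ℕ → V → V} {θ θ' : ℕ → ℕ → V} {a b c d : ℕ}
    (hΦ : GermFam η g1 g2 M x y Φ) (hx : Monotone x) (hy : Monotone y) (hM : 0 ≤ M) (hK : 0 ≤ K)
    (hB : 0 ≤ B) (hη0 : 0 < η) (hη1 : η < 1) (hg1 : 1/2 < g1) (hg2 : 1/2 < g2)
    (hp1 : 1 < g1 * (1 + η)) (hh : h ≤ 1) (hab : a < b) (hcd : c < d)
    (hX : x b - x a ≤ h) (hY : y d - y c ≤ h)
    (k1 : ∀ i u j, a ≤ i → i ≤ u → u ≤ b → c ≤ j → j ≤ d →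
      ‖θ i j - θ u j‖ ≤ K * (x u - x i) ^ g1)
    (k1' : ∀ i u j, a ≤ i → i ≤ u → u ≤ b → c ≤ j → j ≤ d →
      ‖θ' i j - θ' u j‖ ≤ K * (x u - x i) ^ g1)
    (k2 : ∀ i j v, a ≤ i → i ≤ b → c ≤ j → j ≤ v → v ≤ d →
      ‖θ i j - θ i v‖ ≤ K * (y v - y j) ^ g2)
    (k2' : ∀ i j v, a ≤ i → i ≤ b → c ≤ j → j ≤ v → v ≤ d →
      ‖θ' i j - θ' i v‖ ≤ K * (y v - y j) ^ g2)
    (k12 : ∀ i u j v, a ≤ i → i ≤ u → u ≤ b → c ≤ j → j ≤ v → v ≤ d →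
      ‖θ i j - θ u j - θ i v + θ u v‖ ≤ K * (x u - x i) ^ g1 * (y v - y j) ^ g2)
    (k12' : ∀ i u j v, a ≤ i → i ≤ u → u ≤ b → c ≤ j → j ≤ v → v ≤ d →
      ‖θ' i j - θ' u j - θ' i v + θ' u v‖ ≤ K * (x u - x i) ^ g1 * (y v - y j) ^ g2)
    (w0 : ∀ i j, a ≤ i → i ≤ b → c ≤ j → j ≤ d → ‖θ i j - θ' i j‖ ≤ B * h ^ g1 * h ^ g2)
    (w1 : ∀ i u j, a ≤ i → i ≤ u → u ≤ b → c ≤ j → j ≤ d →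
      ‖(θ i j - θ' i j) - (θ u j - θ' u j)‖ ≤ B * (x u - x i) ^ g1 * h ^ g2)
    (w2 : ∀ i j v, a ≤ i → i ≤ b → c ≤ j → j ≤ v → v ≤ d →
      ‖(θ i j - θ' i j) - (θ i v - θ' i v)‖ ≤ B * h ^ g1 * (y v - y j) ^ g2)
    (w12 : ∀ i u j v, a ≤ i → i ≤ u → u ≤ b → c ≤ j → j ≤ v → v ≤ d →
      ‖(θ i j - θ' i j) - (θ u j - θ' u j) - (θ i v - θ' i v) + (θ u v - θ' u v)‖
        ≤ B * (x u - x i) ^ g1 * (y v - y j) ^ g2) :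
    ‖∑ i ∈ Finset.Ico a b, ∑ j ∈ Finset.Ico c d,
      (Φ i (i+1) j (j+1) (θ i j) - Φ i (i+1) j (j+1) (θ' i j))‖ ≤
      (M * (h ^ g1 * h ^ g2 + kap (g1 * (1 + η)) * (h ^ g2 + K * h ^ g1 * h ^ g2)
        + kap (g1 * (1 + η)) * kap (2 * g2) * (1 + 3 * K + K ^ η * K) * h ^ g2
        + kap (2 * g2) * (h ^ g1 + K * h ^ g1 * h ^ g2)))
      * (B * (x b - x a) ^ g1 * (y d - y c) ^ g2) := by
  have h0 : 0 ≤ h := (sub_nonneg.2 (hx hab.le)).trans hX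
  have g1' : 0 < g1 := by linarith
  have g2' : 0 < g2 := by linarith
  have H1n : 0 ≤ h ^ g1 := Real.rpow_nonneg h0 _
  have H2n : 0 ≤ h ^ g2 := Real.rpow_nonneg h0 _
  have H1l : h ^ g1 ≤ 1 := Real.rpow_le_one h0 hh g1'.le
  have H2l : h ^ g2 ≤ 1 := Real.rpow_le_one h0 hh g2'.le
  have Kη : 0 ≤ K ^ η := Real.rpow_nonneg hK _
  have hp2 : 1 < 2 * g2 := by linarith
  have κ1 := kap_pos hp1
  have κ2 := kap_pos hp2
  have Xn := rpow_nn hx (g := g1) hab.le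
  have Yn := rpow_nn hy (g := g2) hcd.le
  have xl1 : ∀ i k, a ≤ i → i ≤ k → k ≤ b → x k - x i ≤ 1 := fun i k q1 q2 q3 => by
    linarith [hx q1, hx q3]
  have yl1 : ∀ i k, c ≤ i → i ≤ k → k ≤ d → y k - y i ≤ 1 := fun i k q1 q2 q3 => by
    linarith [hy q1, hy q3]
  set C1 := M * (y d - y c) ^ g2 * B * (h ^ g2 + K * h ^ g1 * h ^ g2) with hC1
  set C2 := M * (x b - x a) ^ g1 * B * (h ^ g1 + K * h ^ g1 * h ^ g2) with hC2
  set D := 1 + 3 * K + K ^ η * K with hD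
  have hC1n : 0 ≤ C1 := by positivity
  have hC2n : 0 ≤ C2 := by positivity
  have hDn : 0 ≤ D := by positivity
  have S := sew2 hx hy (G := fun i k j l => Φ i k j l (θ i j) - Φ i k j l (θ' i j)) hp1 hp2
    (C1 := C1) (C2 := C2) (C12 := M * B * D) hC1n hC2n (by positivity) hab hcd ?_ ?_ ?_
  · have Gb : ‖Φ a b c d (θ a c) - Φ a b c d (θ' a c)‖ ≤
        M * ((x b - x a) ^ g1 * (y d - y c) ^ g2) * (B * h ^ g1 * h ^ g2) := by
      obtain ⟨F', F'', hF⟩ := hΦ.reg a b c d hab.le hcd.le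
      exact (hF.lip _ _).trans (mul_le_mul_of_nonneg_left
        (w0 a c le_rfl hab.le le_rfl hcd.le) hF.nonneg)
    have tri : ∀ u v : V, ‖u‖ ≤ ‖u - v‖ + ‖v‖ := fun u v => by
      simpa using norm_add_le (u - v) v
    refine (tri _ _).trans ((add_le_add S Gb).trans ?_)
    have X1 : (x b - x a) ^ (g1 * (1 + η)) ≤ (x b - x a) ^ g1 := by
      apply Real.rpow_le_rpow_of_exponent_ge_of_imp (sub_nonneg.2 (hx hab.le))
        (xl1 _ _ le_rfl hab.le le_rfl) (by nlinarith)
      intro _ q; linarith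
    have Y1 : (y d - y c) ^ (2 * g2) ≤ (y d - y c) ^ g2 * h ^ g2 := by
      rw [rpow_two_mul (sub_nonneg.2 (hy hcd.le)) g2'.le]
      gcongr
      exact sub_nonneg.2 (hy hcd.le)
    have Y2 : (y d - y c) ^ (2 * g2) ≤ (y d - y c) ^ g2 := by nlinarith
    have Xn2 : 0 ≤ (x b - x a) ^ (g1 * (1 + η)) := rpow_nn hx hab.le
    have Yn2 : 0 ≤ (y d - y c) ^ (2 * g2) := rpow_nn hy hcd.le
    calc _ ≤ kap (g1 * (1 + η)) * (C1 + kap (2 * g2) * (M * B * D) * ((y d - y c) ^ g2 * h ^ g2))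
            * (x b - x a) ^ g1 + kap (2 * g2) * C2 * (y d - y c) ^ g2
            + M * ((x b - x a) ^ g1 * (y d - y c) ^ g2) * (B * h ^ g1 * h ^ g2) := by
          gcongr
      _ = _ := by rw [hC1, hC2]; ring
  · intro i u k q1 q2 q3 q4
    obtain ⟨F', F'', hF⟩ := hΦ.reg u k c d q3.le hcd.le
    have e1 := hΦ.d1_eq (θ := θ) i u k c d
    have e2 := hΦ.d1_eq (θ := θ') i u k c d
    have e : (Φ i k c d (θ i c) - Φ i k c d (θ' i c)) - (Φ i u c d (θ i c) - Φ i u c d (θ' i c))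
        - (Φ u k c d (θ u c) - Φ u k c d (θ' u c))
        = Φ u k c d (θ i c) - Φ u k c d (θ u c) - Φ u k c d (θ' i c) + Φ u k c d (θ' u c) := by
      rw [show Φ u k c d (θ i c) - Φ u k c d (θ u c) - Φ u k c d (θ' i c) + Φ u k c d (θ' u c)
        = (Φ u k c d (θ i c) - Φ u k c d (θ u c)) - (Φ u k c d (θ' i c) - Φ u k c d (θ' u c)) by
          abel, ← e1, ← e2]
      abel
    rw [e]
    have f := hF.four (θ i c) (θ u c) (θ' i c) (θ' u c)
    have r1 : ‖θ i c - θ u c - θ' i c + θ' u c‖ ≤ B * (x u - x i) ^ g1 * h ^ g2 := by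
      have := w1 i u c q1 q2.le (by omega) le_rfl hcd.le
      rwa [show θ i c - θ u c - θ' i c + θ' u c = (θ i c - θ' i c) - (θ u c - θ' u c) by abel]
    have r2 := k1' i u c q1 q2.le (by omega) le_rfl hcd.le
    have r3 := w0 u c (by omega) (by omega) le_rfl hcd.le
    have m1 : (x u - x i) ^ g1 ≤ (x k - x i) ^ g1 := rpow_mono' hx g1'.le le_rfl q2.le q3.le
    have m2 : (x k - x u) ^ g1 ≤ (x k - x i) ^ g1 := rpow_mono' hx g1'.le q2.le q3.le le_rfl
    have n1 := rpow_nn hx (g := g1) q2.le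
    have n2 := rpow_nn hx (g := g1) q3.le
    have n3 := rpow_nn hx (g := g1) (q2.trans q3).le
    have m3 : (x k - x i) ^ g1 * (x k - x i) ^ g1 ≤ (x k - x i) ^ (g1 * (1 + η)) := by
      rw [← rpow_two_mul (sub_nonneg.2 (hx (q2.trans q3).le)) g1'.le]
      apply Real.rpow_le_rpow_of_exponent_ge_of_imp (sub_nonneg.2 (hx (q2.trans q3).le))
        (xl1 _ _ q1 (q2.trans q3).le q4) (by nlinarith)
      intro _ q; linarith
    calc _ ≤ _ := f
      _ ≤ M * ((x k - x i) ^ g1 * (y d - y c) ^ g2) * (B * (x k - x i) ^ g1 * h ^ g2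
          + (K * (x k - x i) ^ g1) * (B * h ^ g1 * h ^ g2)) := by
        gcongr
        · exact r1.trans (by gcongr)
        · exact r2.trans (by gcongr)
      _ = C1 * ((x k - x i) ^ g1 * (x k - x i) ^ g1) := by rw [hC1]; ring
      _ ≤ _ := by gcongr
  · intro j v l q1 q2 q3 q4
    obtain ⟨F', F'', hF⟩ := hΦ.reg a b v l hab.le q3.le
    have e1 := hΦ.d2_eq (θ := θ) a b j v l
    have e2 := hΦ.d2_eq (θ := θ') a b j v l
    have e : (Φ a b j l (θ a j) - Φ a b j l (θ' a j)) - (Φ a b j v (θ a j) - Φ a b j v (θ' a j))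
        - (Φ a b v l (θ a v) - Φ a b v l (θ' a v))
        = Φ a b v l (θ a j) - Φ a b v l (θ a v) - Φ a b v l (θ' a j) + Φ a b v l (θ' a v) := by
      rw [show Φ a b v l (θ a j) - Φ a b v l (θ a v) - Φ a b v l (θ' a j) + Φ a b v l (θ' a v)
        = (Φ a b v l (θ a j) - Φ a b v l (θ a v)) - (Φ a b v l (θ' a j) - Φ a b v l (θ' a v)) by
          abel, ← e1, ← e2]
      abel
    rw [e]
    have f := hF.four (θ a j) (θ a v) (θ' a j) (θ' a v)
    have r1 : ‖θ a j - θ a v - θ' a j + θ' a v‖ ≤ B * h ^ g1 * (y v - y j) ^ g2 := by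
      have := w2 a j v le_rfl hab.le q1 q2.le (by omega)
      rwa [show θ a j - θ a v - θ' a j + θ' a v = (θ a j - θ' a j) - (θ a v - θ' a v) by abel]
    have r2 := k2' a j v le_rfl hab.le q1 q2.le (by omega)
    have r3 := w0 a v le_rfl hab.le (by omega) (by omega)
    have m1 : (y v - y j) ^ g2 ≤ (y l - y j) ^ g2 := rpow_mono' hy g2'.le le_rfl q2.le q3.le
    have m2 : (y l - y v) ^ g2 ≤ (y l - y j) ^ g2 := rpow_mono' hy g2'.le q2.le q3.le le_rfl
    have n1 := rpow_nn hy (g := g2) q2.le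
    have n2 := rpow_nn hy (g := g2) q3.le
    have n3 := rpow_nn hy (g := g2) (q2.trans q3).le
    calc _ ≤ _ := f
      _ ≤ M * ((x b - x a) ^ g1 * (y l - y j) ^ g2) * (B * h ^ g1 * (y l - y j) ^ g2
          + (K * (y l - y j) ^ g2) * (B * h ^ g1 * h ^ g2)) := by
        gcongr
        · exact r1.trans (by gcongr)
        · exact r2.trans (by gcongr)
      _ = C2 * ((y l - y j) ^ g2 * (y l - y j) ^ g2) := by rw [hC2]; ring
      _ = _ := by rw [rpow_two_mul (sub_nonneg.2 (hy (q2.trans q3).le)) g2'.le]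
  · intro i u k j v l q1 q2 q3 q4 s1 s2 s3 s4
    obtain ⟨F', F'', hF⟩ := hΦ.reg u k v l q3.le s3.le
    have e1 := hΦ.d12_eq (θ := θ) i u k j v l
    have e2 := hΦ.d12_eq (θ := θ') i u k j v l
    have e : ((Φ i k j l (θ i j) - Φ i k j l (θ' i j)) - (Φ i u j l (θ i j) - Φ i u j l (θ' i j))
          - (Φ u k j l (θ u j) - Φ u k j l (θ' u j)))
        - ((Φ i k j v (θ i j) - Φ i k j v (θ' i j)) - (Φ i u j v (θ i j) - Φ i u j v (θ' i j))
          - (Φ u k j v (θ u j) - Φ u k j v (θ' u j)))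
        - ((Φ i k v l (θ i v) - Φ i k v l (θ' i v)) - (Φ i u v l (θ i v) - Φ i u v l (θ' i v))
          - (Φ u k v l (θ u v) - Φ u k v l (θ' u v)))
        = (Φ u k v l (θ i j) - Φ u k v l (θ u j) - Φ u k v l (θ i v) + Φ u k v l (θ u v))
          - (Φ u k v l (θ' i j) - Φ u k v l (θ' u j) - Φ u k v l (θ' i v) + Φ u k v l (θ' u v)) := by
      rw [← e1, ← e2]
      abel
    rw [e]
    have hub : u ≤ b := by omega
    have hvd : v ≤ d := by omega
    have hau : a ≤ u := by omega
    have hcv : c ≤ v := by omega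
    have hib : i ≤ b := by omega
    have hjd : j ≤ d := by omega
    have f := hF.eight hη0.le (k1 i u j q1 q2.le hub s1 hjd) (k1' i u j q1 q2.le hub s1 hjd)
      (k1 i u v q1 q2.le hub hcv hvd) (k1' i u v q1 q2.le hub hcv hvd)
      (k2 i j v q1 hib s1 s2.le hvd) (k2' i j v q1 hib s1 s2.le hvd)
      (k2 u j v hau hub s1 s2.le hvd) (k2' u j v hau hub s1 s2.le hvd)
      (k12 i u j v q1 q2.le hub s1 s2.le hvd) (k12' i u j v q1 q2.le hub s1 s2.le hvd)
    have r1 := w12 i u j v q1 q2.le hub s1 s2.le hvd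
    have r2 := w2 u j v hau hub s1 s2.le hvd
    have r3 := w1 i u v q1 q2.le hub hcv hvd
    have r4 := w0 u v hau hub hcv hvd
    have n1 := rpow_nn hx (g := g1) q2.le
    have n2 := rpow_nn hx (g := g1) q3.le
    have n3 := rpow_nn hx (g := g1) (q2.trans q3).le
    have N1 := rpow_nn hy (g := g2) s2.le
    have N2 := rpow_nn hy (g := g2) s3.le
    have N3 := rpow_nn hy (g := g2) (s2.trans s3).le
    have m1 : (x u - x i) ^ g1 ≤ (x k - x i) ^ g1 := rpow_mono' hx g1'.le le_rfl q2.le q3.le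
    have m2 : (x k - x u) ^ g1 ≤ (x k - x i) ^ g1 := rpow_mono' hx g1'.le q2.le q3.le le_rfl
    have l1 : (y v - y j) ^ g2 ≤ (y l - y j) ^ g2 := rpow_mono' hy g2'.le le_rfl s2.le s3.le
    have l2 : (y l - y v) ^ g2 ≤ (y l - y j) ^ g2 := rpow_mono' hy g2'.le s2.le s3.le le_rfl
    set p := (x u - x i) ^ g1 with hp
    set q := (y v - y j) ^ g2 with hq
    have p1 : p ≤ 1 := Real.rpow_le_one (sub_nonneg.2 (hx q2.le)) (xl1 _ _ q1 q2.le hub) g1'.le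
    have pη : p ≤ p ^ η := by
      have : p ^ (1:ℝ) ≤ p ^ η := Real.rpow_le_rpow_of_exponent_ge_of_imp n1 p1 hη1.le
        (fun _ q => by linarith)
      rwa [Real.rpow_one] at this
    have pn : 0 ≤ p ^ η := Real.rpow_nonneg n1 _
    have big : ‖(θ i j - θ' i j) - (θ u j - θ' u j) - (θ i v - θ' i v) + (θ u v - θ' u v)‖
        + K * p * ‖(θ u j - θ' u j) - (θ u v - θ' u v)‖
        + K * q * ‖(θ i v - θ' i v) - (θ u v - θ' u v)‖
        + (K * p * q + (K * p) ^ η * (K * q)) * ‖θ u v - θ' u v‖ ≤ B * D * (p ^ η * q) := by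
      calc _ ≤ B * p * q + K * p * (B * h ^ g1 * q) + K * q * (B * p * h ^ g2)
            + (K * p * q + (K * p) ^ η * (K * q)) * (B * h ^ g1 * h ^ g2) := by
              have : 0 ≤ (K * p) ^ η := Real.rpow_nonneg (by positivity) _
              gcongr
        _ ≤ B * p * q + K * p * (B * 1 * q) + K * q * (B * p * 1)
            + (K * p * q + (K * p) ^ η * (K * q)) * (B * 1 * 1) := by
              have : 0 ≤ (K * p) ^ η := Real.rpow_nonneg (by positivity) _
              gcongr
        _ = B * q * ((1 + 3 * K) * p + K ^ η * p ^ η * K) := by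
              rw [Real.mul_rpow hK n1]; ring
        _ ≤ B * q * ((1 + 3 * K) * p ^ η + K ^ η * p ^ η * K) := by gcongr
        _ = _ := by rw [hD]; ring
    have xx : (x k - x u) ^ g1 * p ^ η ≤ (x k - x i) ^ (g1 * (1 + η)) := by
      have e : (x k - x i) ^ (g1 * (1 + η)) = (x k - x i) ^ g1 * ((x k - x i) ^ g1) ^ η := by
        have nn := sub_nonneg.2 (hx (q2.trans q3).le)
        rw [← Real.rpow_mul nn, ← Real.rpow_add_of_nonneg nn g1'.le (by positivity)]
        congr 1; ring
      rw [e]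
      gcongr
    have yy : (y l - y v) ^ g2 * q ≤ (y l - y j) ^ (2 * g2) := by
      rw [rpow_two_mul (sub_nonneg.2 (hy (s2.trans s3).le)) g2'.le]
      gcongr
    refine f.trans ((mul_le_mul_of_nonneg_left big hF.nonneg).trans ?_)
    calc _ = M * B * D * (((x k - x u) ^ g1 * p ^ η) * ((y l - y v) ^ g2 * q)) := by ring
      _ ≤ M * B * D * ((x k - x i) ^ (g1 * (1 + η)) * (y l - y j) ^ (2 * g2)) := by
        gcongr
        exact rpow_nn hx (q2.trans q3).le
      _ = _ := by ring


/-- The contraction factor on a cell of side length `h`. -/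
def cfac (η g1 g2 M K h : ℝ) : ℝ :=
  M * (h ^ g1 * h ^ g2 + kap (g1 * (1 + η)) * (h ^ g2 + K * h ^ g1 * h ^ g2)
        + kap (g1 * (1 + η)) * kap (2 * g2) * (1 + 3 * K + K ^ η * K) * h ^ g2
        + kap (2 * g2) * (h ^ g1 + K * h ^ g1 * h ^ g2))

/-- Hölder bounds with constant `K` on the square. -/
structure HB {V : Type*} [NormedAddCommGroup V] (T : ℝ) (γ : ℝ × ℝ) (K : ℝ) (f : ℝ × ℝ → V) :
    Prop where
  k1 : ∀ s u v, s ∈ Icc 0 T → u ∈ Icc 0 T → v ∈ Icc 0 T → s ≤ u →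
    ‖f (s, v) - f (u, v)‖ ≤ K * (u - s) ^ γ.1
  k2 : ∀ s u v, s ∈ Icc 0 T → u ∈ Icc 0 T → v ∈ Icc 0 T → s ≤ u →
    ‖f (v, s) - f (v, u)‖ ≤ K * (u - s) ^ γ.2
  k12 : ∀ s u s' u', s ∈ Icc 0 T → u ∈ Icc 0 T → s' ∈ Icc 0 T → u' ∈ Icc 0 T → s ≤ u → s' ≤ u' →
    ‖f (s, s') - f (u, s') - f (s, u') + f (u, u')‖ ≤ K * (u - s) ^ γ.1 * (u' - s') ^ γ.2

lemma HB.of {V : Type*} [NormedAddCommGroup V] {T : ℝ} {γ : ℝ × ℝ} {K K' : ℝ} {f : ℝ × ℝ → V}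
    (hKK : K ≤ K')
    (h1 : ∀ s ∈ Sq T, ∀ t ∈ Sq T, ‖f (t.1, s.2) - f (s.1, s.2)‖ ≤ K * |t.1 - s.1| ^ γ.1)
    (h2 : ∀ s ∈ Sq T, ∀ t ∈ Sq T, ‖f (s.1, t.2) - f (s.1, s.2)‖ ≤ K * |t.2 - s.2| ^ γ.2)
    (h3 : ∀ s ∈ Sq T, ∀ t ∈ Sq T,
      ‖box f s t‖ ≤ K * |t.1 - s.1| ^ γ.1 * |t.2 - s.2| ^ γ.2) : HB T γ K' f := by
  refine ⟨fun s u v hs hu hv q => ?_, fun s u v hs hu hv q => ?_,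
    fun s u s' u' hs hu hs' hu' q q' => ?_⟩
  · have := h1 (s, v) (mem_Sq.2 ⟨hs, hv⟩) (u, v) (mem_Sq.2 ⟨hu, hv⟩)
    rw [norm_sub_rev]
    have n : 0 ≤ (u - s) ^ γ.1 := Real.rpow_nonneg (sub_nonneg.2 q) _
    simp only [abs_of_nonneg (sub_nonneg.2 q)] at this
    exact this.trans (by gcongr)
  · have := h2 (v, s) (mem_Sq.2 ⟨hv, hs⟩) (v, u) (mem_Sq.2 ⟨hv, hu⟩)
    rw [norm_sub_rev]
    have n : 0 ≤ (u - s) ^ γ.2 := Real.rpow_nonneg (sub_nonneg.2 q) _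
    simp only [abs_of_nonneg (sub_nonneg.2 q)] at this
    exact this.trans (by gcongr)
  · have := h3 (s, s') (mem_Sq.2 ⟨hs, hs'⟩) (u, u') (mem_Sq.2 ⟨hu, hu'⟩)
    have n : 0 ≤ (u - s) ^ γ.1 := Real.rpow_nonneg (sub_nonneg.2 q) _
    have n' : 0 ≤ (u' - s') ^ γ.2 := Real.rpow_nonneg (sub_nonneg.2 q') _
    simp only [abs_of_nonneg (sub_nonneg.2 q), abs_of_nonneg (sub_nonneg.2 q'), box] at this
    rw [show f (s, s') - f (u, s') - f (s, u') + f (u, u')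
      = f (u, u') - f (u, s') - f (s, u') + f (s, s') by abel]
    exact this.trans (by gcongr)

section uniq

variable {V : Type*} [NormedAddCommGroup V] [NormedSpace ℝ V] {T : ℝ} {γ : ℝ × ℝ} {η M K h : ℝ}
    {A : ℝ × ℝ → V → V} {DA : ℝ × ℝ → V → V →L[ℝ] V} {D2A : ℝ × ℝ → V → V →L[ℝ] V →L[ℝ] V}
    {ξ θ θ' : ℝ × ℝ → V}

lemma cell_half (hM : 0 ≤ M) (hK : 0 ≤ K) (hη0 : 0 < η) (hη1 : η < 1) (hg1 : 1/2 < γ.1)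
    (hg2 : 1/2 < γ.2) (hp1 : 1 < γ.1 * (1 + η)) (hA : MemCtC2 T γ η A DA D2A M)
    (hξbox : ∀ s ∈ Sq T, ∀ t ∈ Sq T, s ≤ t → box ξ s t = 0)
    (H : HB T γ K θ) (H' : HB T γ K θ')
    (e : ∀ t ∈ Sq T, SewsTo (nlyGerm A θ) (0, 0) t (θ t - ξ t))
    (e' : ∀ t ∈ Sq T, SewsTo (nlyGerm A θ') (0, 0) t (θ' t - ξ t))
    (hh : h ≤ 1) (hE : cfac η γ.1 γ.2 M K h ≤ 1 / 2) {α β : ℝ} (hα : 0 ≤ α) (hβ : 0 ≤ β)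
    (hαT : α + h ≤ T) (hβT : β + h ≤ T)
    (z1 : ∀ v ∈ Icc β (β + h), θ (α, v) = θ' (α, v))
    (z2 : ∀ u ∈ Icc α (α + h), θ (u, β) = θ' (u, β)) {B : ℝ} (hB : 0 ≤ B)
    (hyp : ∀ s u s' u', α ≤ s → s ≤ u → u ≤ α + h → β ≤ s' → s' ≤ u' → u' ≤ β + h →
      ‖(θ (s, s') - θ' (s, s')) - (θ (u, s') - θ' (u, s')) - (θ (s, u') - θ' (s, u'))
        + (θ (u, u') - θ' (u, u'))‖ ≤ B * (u - s) ^ γ.1 * (u' - s') ^ γ.2) :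
    ∀ s u s' u', α ≤ s → s ≤ u → u ≤ α + h → β ≤ s' → s' ≤ u' → u' ≤ β + h →
      ‖(θ (s, s') - θ' (s, s')) - (θ (u, s') - θ' (u, s')) - (θ (s, u') - θ' (s, u'))
        + (θ (u, u') - θ' (u, u'))‖ ≤ B / 2 * (u - s) ^ γ.1 * (u' - s') ^ γ.2 := by
  intro s u s' u' q1 q2 q3 q4 q5 q6
  have g1 : 0 < γ.1 := by linarith
  have g2 : 0 < γ.2 := by linarith
  have h0 : 0 ≤ h := by linarith
  have H1n : 0 ≤ h ^ γ.1 := Real.rpow_nonneg h0 _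
  have H2n : 0 ≤ h ^ γ.2 := Real.rpow_nonneg h0 _
  have w0 : ∀ p r, α ≤ p → p ≤ α + h → β ≤ r → r ≤ β + h →
      ‖θ (p, r) - θ' (p, r)‖ ≤ B * h ^ γ.1 * h ^ γ.2 := by
    intro p r p1 p2 r1 r2
    have := hyp α p β r le_rfl p1 p2 le_rfl r1 r2
    rw [z1 β ⟨le_rfl, by linarith⟩, z2 p ⟨p1, p2⟩, z1 r ⟨r1, r2⟩] at this
    simp only [sub_self, zero_add] at this
    refine this.trans ?_
    have a1 : (p - α) ^ γ.1 ≤ h ^ γ.1 := Real.rpow_le_rpow (by linarith) (by linarith) g1.le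
    have a2 : (r - β) ^ γ.2 ≤ h ^ γ.2 := Real.rpow_le_rpow (by linarith) (by linarith) g2.le
    have a3 : 0 ≤ (r - β) ^ γ.2 := Real.rpow_nonneg (by linarith) _
    gcongr
  have w1 : ∀ p p' r, α ≤ p → p ≤ p' → p' ≤ α + h → β ≤ r → r ≤ β + h →
      ‖(θ (p, r) - θ' (p, r)) - (θ (p', r) - θ' (p', r))‖ ≤ B * (p' - p) ^ γ.1 * h ^ γ.2 := by
    intro p p' r p1 p2 p3 r1 r2
    have := hyp p p' β r p1 p2 p3 le_rfl r1 r2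
    rw [z2 p ⟨p1, p2.trans p3⟩, z2 p' ⟨p1.trans p2, p3⟩] at this
    simp only [sub_self, zero_sub] at this
    rw [← norm_neg, neg_sub, sub_eq_neg_add]
    refine this.trans ?_
    have a1 : 0 ≤ (p' - p) ^ γ.1 := Real.rpow_nonneg (by linarith) _
    have a2 : (r - β) ^ γ.2 ≤ h ^ γ.2 := Real.rpow_le_rpow (by linarith) (by linarith) g2.le
    gcongr
  have w2 : ∀ p r r', α ≤ p → p ≤ α + h → β ≤ r → r ≤ r' → r' ≤ β + h →
      ‖(θ (p, r) - θ' (p, r)) - (θ (p, r') - θ' (p, r'))‖ ≤ B * h ^ γ.1 * (r' - r) ^ γ.2 := by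
    intro p r r' p1 p2 r1 r2 r3
    have := hyp α p r r' le_rfl p1 p2 r1 r2 r3
    rw [z1 r ⟨r1, r2.trans r3⟩, z1 r' ⟨r1.trans r2, r3⟩] at this
    simp only [sub_self, zero_sub, sub_zero] at this
    rw [← norm_neg, neg_sub, sub_eq_neg_add]
    refine this.trans ?_
    have a1 : 0 ≤ (r' - r) ^ γ.2 := Real.rpow_nonneg (by linarith) _
    have a2 : (p - α) ^ γ.1 ≤ h ^ γ.1 := Real.rpow_le_rpow (by linarith) (by linarith) g1.le
    gcongr
  have m1 : (s, s') ∈ Sq T := mem_Sq.2 ⟨⟨by linarith, by linarith⟩, ⟨by linarith, by linarith⟩⟩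
  have m2 : (u, u') ∈ Sq T := mem_Sq.2 ⟨⟨by linarith, by linarith⟩, ⟨by linarith, by linarith⟩⟩
  have L := (box_limit hξbox e m1 m2 ⟨q2, q5⟩).sub (box_limit hξbox e' m1 m2 ⟨q2, q5⟩)
  have eb : box θ (s, s') (u, u') - box θ' (s, s') (u, u')
      = (θ (s, s') - θ' (s, s')) - (θ (u, s') - θ' (u, s')) - (θ (s, u') - θ' (s, u'))
        + (θ (u, u') - θ' (u, u')) := by
    unfold box; abel
  rw [← eb]
  refine le_of_tendsto L.norm (Filter.Eventually.of_forall fun k => ?_)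
  simp only [← Finset.sum_sub_distrib]
  have s0 : 0 ≤ s := by linarith
  have s0' : 0 ≤ s' := by linarith
  have kp := Nat.succ_pos k
  have xm := dseq_mono s0 q2 (k+1)
  have ym := dseq_mono s0' q5 (k+1)
  have xT := dseq_mem s0 q2 (q3.trans hαT) kp
  have yT := dseq_mem s0' q5 (q6.trans hβT) kp
  have x1 := dseq_mid s0 q2 kp
  have y1 := dseq_mid s0' q5 kp
  have x2 := dseq_top s0 q2 kp (le_refl (2 * (k+1)))
  have y2 := dseq_top s0' q5 kp (le_refl (2 * (k+1)))
  simp only [Nat.succ_eq_add_one] at xT yT x1 y1 x2 y2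
  set x := dseq s u (k+1)
  set y := dseq s' u' (k+1)
  have xl : ∀ {i}, k + 1 ≤ i → α ≤ x i := fun hi => by linarith [xm hi]
  have yl : ∀ {i}, k + 1 ≤ i → β ≤ y i := fun hi => by linarith [ym hi]
  have xu : ∀ {i}, i ≤ 2 * (k + 1) → x i ≤ α + h := fun hi => by linarith [xm hi]
  have yu : ∀ {i}, i ≤ 2 * (k + 1) → y i ≤ β + h := fun hi => by linarith [ym hi]
  have C := contract (germFam_of hA xm ym xT yT) (θ := fun i j => θ (x i, y j))
    (θ' := fun i j => θ' (x i, y j)) (K := K) (B := B) (h := h) (a := k + 1) (b := 2 * (k + 1))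
    (c := k + 1) (d := 2 * (k + 1)) xm ym hM hK hB hη0 hη1 hg1 hg2 hp1 hh (by omega) (by omega)
    (by rw [x1, x2]; linarith) (by rw [y1, y2]; linarith)
    (fun i u j _ b _ _ _ => H.k1 _ _ _ (xT i) (xT u) (yT j) (xm b))
    (fun i u j _ b _ _ _ => H'.k1 _ _ _ (xT i) (xT u) (yT j) (xm b))
    (fun i u j _ _ _ b _ => H.k2 _ _ _ (yT u) (yT j) (xT i) (ym b))
    (fun i u j _ _ _ b _ => H'.k2 _ _ _ (yT u) (yT j) (xT i) (ym b))
    (fun i u j v _ b _ _ b' _ => H.k12 _ _ _ _ (xT i) (xT u) (yT j) (yT v) (xm b) (ym b'))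
    (fun i u j v _ b _ _ b' _ => H'.k12 _ _ _ _ (xT i) (xT u) (yT j) (yT v) (xm b) (ym b'))
    (fun i j a b c d => w0 _ _ (xl a) (xu b) (yl c) (yu d))
    (fun i u j a b c d e => w1 _ _ _ (xl a) (xm b) (xu c) (yl d) (yu e))
    (fun i j v a b c d e => w2 _ _ _ (xl a) (xu b) (yl c) (ym d) (yu e))
    (fun i u j v a b c d e f => hyp _ _ _ _ (xl a) (xm b) (xu c) (yl d) (ym e) (yu f))
  rw [x1, x2, y1, y2] at C
  refine C.trans ?_
  have n1 : 0 ≤ (u - s) ^ γ.1 := Real.rpow_nonneg (by linarith) _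
  have n2 : 0 ≤ (u' - s') ^ γ.2 := Real.rpow_nonneg (by linarith) _
  calc _ ≤ 1 / 2 * (B * (u - s) ^ γ.1 * (u' - s') ^ γ.2) :=
        mul_le_mul_of_nonneg_right hE (by positivity)
    _ = _ := by ring

lemma cell_zero (hM : 0 ≤ M) (hK : 0 ≤ K) (hη0 : 0 < η) (hη1 : η < 1) (hg1 : 1/2 < γ.1)
    (hg2 : 1/2 < γ.2) (hp1 : 1 < γ.1 * (1 + η)) (hA : MemCtC2 T γ η A DA D2A M)
    (hξbox : ∀ s ∈ Sq T, ∀ t ∈ Sq T, s ≤ t → box ξ s t = 0)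
    (H : HB T γ K θ) (H' : HB T γ K θ')
    (e : ∀ t ∈ Sq T, SewsTo (nlyGerm A θ) (0, 0) t (θ t - ξ t))
    (e' : ∀ t ∈ Sq T, SewsTo (nlyGerm A θ') (0, 0) t (θ' t - ξ t))
    (hh : h ≤ 1) (hE : cfac η γ.1 γ.2 M K h ≤ 1 / 2) {α β : ℝ} (hα : 0 ≤ α) (hβ : 0 ≤ β)
    (hαT : α + h ≤ T) (hβT : β + h ≤ T)
    (z1 : ∀ v ∈ Icc β (β + h), θ (α, v) = θ' (α, v))
    (z2 : ∀ u ∈ Icc α (α + h), θ (u, β) = θ' (u, β)) :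
    ∀ u ∈ Icc α (α + h), ∀ v ∈ Icc β (β + h), θ (u, v) = θ' (u, v) := by
  have it : ∀ n : ℕ, ∀ s u s' u', α ≤ s → s ≤ u → u ≤ α + h → β ≤ s' → s' ≤ u' → u' ≤ β + h →
      ‖(θ (s, s') - θ' (s, s')) - (θ (u, s') - θ' (u, s')) - (θ (s, u') - θ' (s, u'))
        + (θ (u, u') - θ' (u, u'))‖ ≤ 2 * K * (1 / 2) ^ n * (u - s) ^ γ.1 * (u' - s') ^ γ.2 := by
    intro n
    induction n with
    | zero =>
      intro s u s' u' q1 q2 q3 q4 q5 q6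
      have b1 : s ∈ Icc 0 T := ⟨by linarith, by linarith⟩
      have b2 : u ∈ Icc 0 T := ⟨by linarith, by linarith⟩
      have b3 : s' ∈ Icc 0 T := ⟨by linarith, by linarith⟩
      have b4 : u' ∈ Icc 0 T := ⟨by linarith, by linarith⟩
      have a1 := H.k12 _ _ _ _ b1 b2 b3 b4 q2 q5
      have a2 := H'.k12 _ _ _ _ b1 b2 b3 b4 q2 q5
      rw [show (θ (s, s') - θ' (s, s')) - (θ (u, s') - θ' (u, s')) - (θ (s, u') - θ' (s, u'))
        + (θ (u, u') - θ' (u, u')) = (θ (s, s') - θ (u, s') - θ (s, u') + θ (u, u'))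
          - (θ' (s, s') - θ' (u, s') - θ' (s, u') + θ' (u, u')) by abel]
      refine (norm_sub_le _ _).trans ((add_le_add a1 a2).trans (le_of_eq ?_))
      ring
    | succ n ih =>
      have := cell_half hM hK hη0 hη1 hg1 hg2 hp1 hA hξbox H H' e e' hh hE hα hβ hαT hβT z1 z2
        (by positivity) ih
      intro s u s' u' q1 q2 q3 q4 q5 q6
      refine (this s u s' u' q1 q2 q3 q4 q5 q6).trans (le_of_eq ?_)
      rw [pow_succ]; ring
  intro u hu v hv
  have lim : Tendsto (fun n : ℕ => 2 * K * (1 / 2 : ℝ) ^ n * (u - α) ^ γ.1 * (v - β) ^ γ.2) atTop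
      (𝓝 (2 * K * 0 * (u - α) ^ γ.1 * (v - β) ^ γ.2)) :=
    (((tendsto_pow_atTop_nhds_zero_of_lt_one (by norm_num) (by norm_num)).const_mul _).mul_const
      _).mul_const _
  have := ge_of_tendsto' lim fun n => it n α u β v le_rfl hu.1 hu.2 le_rfl hv.1 hv.2
  have h0 : 0 ≤ h := by linarith [hu.1, hu.2]
  rw [z1 β ⟨le_rfl, by linarith⟩, z2 u hu, z1 v hv] at this
  simp only [sub_self, zero_add, mul_zero, zero_mul] at this
  exact sub_eq_zero.1 (norm_le_zero_iff.1 this)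

lemma choose_h (hT : 0 < T) (hg1 : 1/2 < γ.1) (hg2 : 1/2 < γ.2) :
    ∃ N : ℕ, 0 < N ∧ T / N ≤ 1 ∧ cfac η γ.1 γ.2 M K (T / N) ≤ 1 / 2 := by
  have h0 : Tendsto (fun N : ℕ => T / (N:ℝ)) atTop (𝓝 0) := tendsto_const_div_atTop_nhds_zero_nat T
  have pw : ∀ g : ℝ, 0 < g → Tendsto (fun N : ℕ => (T / (N:ℝ)) ^ g) atTop (𝓝 0) := by
    intro g hg
    have := h0.rpow_const (p := g) (Or.inr hg.le)
    rwa [Real.zero_rpow hg.ne'] at this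
  have hu := pw γ.1 (by linarith)
  have hv := pw γ.2 (by linarith)
  have hall := ((((hu.mul hv).add ((hv.add ((hu.const_mul K).mul hv)).const_mul
    (kap (γ.1 * (1 + η))))).add (hv.const_mul
      (kap (γ.1 * (1 + η)) * kap (2 * γ.2) * (1 + 3 * K + K ^ η * K)))).add
      ((hu.add ((hu.const_mul K).mul hv)).const_mul (kap (2 * γ.2)))).const_mul M
  simp only [mul_zero, add_zero] at hall
  obtain ⟨N, ⟨hN1, hN2⟩, hN3⟩ := (((hall.eventually_le_const (show (0:ℝ) < 1/2 by norm_num)).and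
    (h0.eventually_le_const (show (0:ℝ) < 1 by norm_num))).and (eventually_gt_atTop 0)).exists
  exact ⟨N, hN3, hN2, hN1⟩

lemma uniq (hT : 0 < T) (hM : 0 ≤ M) (hη0 : 0 < η) (hη1 : η < 1) (hg1 : 1/2 < γ.1)
    (hg2 : 1/2 < γ.2) (hp1 : 1 < γ.1 * (1 + η)) (hA : MemCtC2 T γ η A DA D2A M)
    (hξbox : ∀ s ∈ Sq T, ∀ t ∈ Sq T, s ≤ t → box ξ s t = 0)
    (hθ : MemHolder (Sq T) γ θ) (hθ' : MemHolder (Sq T) γ θ')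
    (e : ∀ t ∈ Sq T, SewsTo (nlyGerm A θ) (0, 0) t (θ t - ξ t))
    (e' : ∀ t ∈ Sq T, SewsTo (nlyGerm A θ') (0, 0) t (θ' t - ξ t)) :
    EqOn θ θ' (Sq T) := by
  have g1 : 0 < γ.1 := by linarith
  have g2 : 0 < γ.2 := by linarith
  obtain ⟨K1, hK1, a1, a2, a3⟩ := (memHolder_iff g1 g2 θ).1 hθ
  obtain ⟨K2, hK2, b1, b2, b3⟩ := (memHolder_iff g1 g2 θ').1 hθ'
  set K := max K1 K2
  have hK : 0 ≤ K := hK1.trans (le_max_left _ _)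
  have H : HB T γ K θ := HB.of (le_max_left _ _) a1 a2 a3
  have H' : HB T γ K θ' := HB.of (le_max_right _ _) b1 b2 b3
  obtain ⟨N, hN, hh, hE⟩ := choose_h (T := T) (γ := γ) (η := η) (M := M) (K := K) hT hg1 hg2
  have hN' : (0:ℝ) < N := by exact_mod_cast hN
  set h := T / (N:ℝ) with hdef
  have hpos : 0 < h := by positivity
  have hNT : (N:ℝ) * h = T := by rw [hdef]; field_simp
  have main : ∀ I J : ℕ, I ≤ N → J ≤ N → ∀ u ∈ Icc 0 (I * h), ∀ v ∈ Icc 0 (J * h),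
      θ (u, v) = θ' (u, v) := by
    intro I
    induction I with
    | zero =>
      intro J _ hJ u hu v hv
      have hJ' : (J:ℝ) ≤ N := by exact_mod_cast hJ
      have u0 : u = 0 := by
        have := hu.1; have := hu.2; push_cast at this; linarith
      have vT : v ∈ Icc 0 T := ⟨hv.1, by nlinarith [hv.2]⟩
      rw [u0, axis2 hT e vT, axis2 hT e' vT]
    | succ I ihI =>
      intro J
      induction J with
      | zero =>
        intro hI _ u hu v hv
        have hI' : ((I + 1 : ℕ):ℝ) ≤ N := by exact_mod_cast hI
        have v0 : v = 0 := by
          have := hv.1; have := hv.2; push_cast at this; linarith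
        have uT : u ∈ Icc 0 T := ⟨hu.1, by nlinarith [hu.2]⟩
        rw [v0, axis1 hT e uT, axis1 hT e' uT]
      | succ J ihJ =>
        intro hI hJ u hu v hv
        have hI' : ((I + 1 : ℕ):ℝ) ≤ N := by exact_mod_cast hI
        have hJ' : ((J + 1 : ℕ):ℝ) ≤ N := by exact_mod_cast hJ
        have p1 := ihI (J + 1) (by omega) hJ
        have p2 := ihJ hI (by omega)
        have I0 : 0 ≤ (I:ℝ) * h := by positivity
        have J0 : 0 ≤ (J:ℝ) * h := by positivity
        have eI : ((I + 1 : ℕ):ℝ) * h = I * h + h := by push_cast; ring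
        have eJ : ((J + 1 : ℕ):ℝ) * h = J * h + h := by push_cast; ring
        have fI : ((I + 1 : ℕ):ℝ) * h ≤ T := by rw [← hNT]; gcongr
        have fJ : ((J + 1 : ℕ):ℝ) * h ≤ T := by rw [← hNT]; gcongr
        rcases le_total u (I * h) with c | c
        · exact p1 u ⟨hu.1, c⟩ v hv
        rcases le_total v (J * h) with c' | c'
        · exact p2 u hu v ⟨hv.1, c'⟩
        rw [eI] at hu fI p2
        rw [eJ] at hv fJ p1
        refine cell_zero hM hK hη0 hη1 hg1 hg2 hp1 hA hξbox H H' e e' hh hE I0 J0 fI fJ ?_ ?_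
          u ⟨c, hu.2⟩ v ⟨c', hv.2⟩
        · intro r hr
          exact p1 _ ⟨I0, le_rfl⟩ r ⟨J0.trans hr.1, hr.2⟩
        · intro r hr
          exact p2 r ⟨I0.trans hr.1, hr.2⟩ _ ⟨J0, le_rfl⟩
  intro t ht
  rw [mem_Sq] at ht
  have := main N N le_rfl le_rfl t.1 (by rw [hNT]; exact ht.1) t.2 (by rw [hNT]; exact ht.2)
  exact this

end uniq

/-- **Existence and uniqueness for 2D nonlinear Young equations.**
The equation `θ_t = ξ_t + ∫_0^t A(ds, θ_s)` is encoded by requiring that the Riemann sums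
of the germ `(u,v) ↦ □_{u,v}A(θ_u)` over `[0,t]` converge to `θ_t - ξ_t` for every
sequence of product partitions with vanishing mesh. -/
theorem nly_equation_existence_uniqueness {d : ℕ} {T : ℝ} (hT : 0 < T)
    (γ : ℝ × ℝ) (η : ℝ)
    (hγ1 : γ.1 ∈ Set.Ioc (1 / 2 : ℝ) 1) (hγ2 : γ.2 ∈ Set.Ioc (1 / 2 : ℝ) 1)
    (hη : η ∈ Set.Ioo (0 : ℝ) 1)
    (hγη1 : 1 < (1 + η) * γ.1) (hγη2 : 1 < (1 + η) * γ.2)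
    (A : ℝ × ℝ → EuclideanSpace ℝ (Fin d) → EuclideanSpace ℝ (Fin d))
    (DA : ℝ × ℝ → EuclideanSpace ℝ (Fin d) →
      EuclideanSpace ℝ (Fin d) →L[ℝ] EuclideanSpace ℝ (Fin d))
    (D2A : ℝ × ℝ → EuclideanSpace ℝ (Fin d) →
      EuclideanSpace ℝ (Fin d) →L[ℝ] EuclideanSpace ℝ (Fin d) →L[ℝ] EuclideanSpace ℝ (Fin d))
    (M : ℝ) (hM : 0 ≤ M) (hA : MemCtC2 T γ η A DA D2A M)
    (ξ : ℝ × ℝ → EuclideanSpace ℝ (Fin d)) (hξ : MemHolder (Sq T) γ ξ)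
    (hξbox : ∀ s ∈ Sq T, ∀ t ∈ Sq T, s ≤ t → box ξ s t = 0) :
    ∃ θ : ℝ × ℝ → EuclideanSpace ℝ (Fin d),
      (MemHolder (Sq T) γ θ ∧
        ∀ t ∈ Sq T, SewsTo (nlyGerm A θ) (0, 0) t (θ t - ξ t)) ∧
      ∀ θ' : ℝ × ℝ → EuclideanSpace ℝ (Fin d),
        MemHolder (Sq T) γ θ' →
        (∀ t ∈ Sq T, SewsTo (nlyGerm A θ') (0, 0) t (θ' t - ξ t)) →
        Set.EqOn θ' θ (Sq T) := by
  obtain ⟨θ, h1, h2⟩ := exists_solution hT hγ1.1 hγ2.1 hM hA hξ hξbox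
  exact ⟨θ, ⟨h1, h2⟩, fun θ' h1' h2' => uniq hT hM hη.1 hη.2 hγ1.1 hγ2.1
    (by linarith [mul_comm γ.1 (1 + η)]) hA hξbox h1' h1 h2' h2⟩

end Plane
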